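/- arXiv:2105.07162 — 11 statements merged into one kernel-verified Lean document; each statement's English description precedes it below -/
import Mathlib

section
/- Let A and G be n×n symmetric positive definite real matrices with A ⪯ G ⪯ ηA for some η ≥ 1 (where ⪯ denotes the Loewner order). Then for any u ∈ ℝⁿ, the SR1 update satisfies A ⪯ SR1(A,G,u) ⪯ G ⪯ ηA. -/
open Matrix

/-- The SR1 quasi-Newton update of `G` with respect to target `A` along direction `u`. -/
noncomputable def SR1 {n : ℕ} (A G : Matrix (Fin n) (Fin n) ℝ) (u : Fin n → ℝ) :
    Matrix (Fin n) (Fin n) ℝ :=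
  if (G - A) *ᵥ u = 0 then G
  else G - (u ⬝ᵥ ((G - A) *ᵥ u))⁻¹ • Matrix.vecMulVec ((G - A) *ᵥ u) ((G - A) *ᵥ u)

/-- The rank-one correction in the SR1 update is positive semidefinite. -/
lemma Matrix.PosSemidef.inv_smul_vecMulVec_mulVec {n : Type*} [Fintype n] {M : Matrix n n ℝ}
    (hM : M.PosSemidef) (u : n → ℝ) :
    ((u ⬝ᵥ (M *ᵥ u))⁻¹ • vecMulVec (M *ᵥ u) (M *ᵥ u)).PosSemidef := by
  refine .smul ?_ (inv_nonneg.mpr (by simpa using hM.dotProduct_mulVec_nonneg u))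
  simpa using posSemidef_vecMulVec_self_star (M *ᵥ u)

/-- Subtracting the rank-one correction along `u` preserves positive semidefiniteness; this is
the Cauchy-Schwarz inequality for the form induced by `M`. -/
lemma Matrix.PosSemidef.sub_inv_smul_vecMulVec_mulVec {n : Type*} [Fintype n] {M : Matrix n n ℝ}
    (hM : M.PosSemidef) (u : n → ℝ) :
    (M - (u ⬝ᵥ (M *ᵥ u))⁻¹ • vecMulVec (M *ᵥ u) (M *ᵥ u)).PosSemidef := by
  refine .of_dotProduct_mulVec_nonneg
    (hM.isHermitian.sub (hM.inv_smul_vecMulVec_mulVec u).isHermitian) fun x => ?_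
  have hsymm : u ⬝ᵥ (M *ᵥ x) = x ⬝ᵥ (M *ᵥ u) := by
    have hT : Mᵀ = M := by simpa using hM.isHermitian.eq
    rw [dotProduct_mulVec, ← mulVec_transpose, hT, dotProduct_comm]
  have h := hM.dotProduct_mulVec_nonneg
    (x - ((u ⬝ᵥ (M *ᵥ u))⁻¹ * (x ⬝ᵥ (M *ᵥ u))) • u)
  simp only [star_trivial, mulVec_sub, mulVec_smul, sub_dotProduct, dotProduct_sub,
    smul_dotProduct, dotProduct_smul, smul_eq_mul, hsymm] at h
  simp only [star_trivial, sub_mulVec, smul_mulVec, vecMulVec_mulVec, dotProduct_sub,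
    dotProduct_smul, smul_eq_mul, op_smul_eq_smul, dotProduct_comm (M *ᵥ u) x]
  refine h.trans_eq ?_
  by_cases hc : u ⬝ᵥ (M *ᵥ u) = 0
  · simp [hc]
  · field_simp
    ring

/-- Lemma 2.1: the SR1 update preserves the Loewner bounds
`A ⪯ SR1(A,G,u) ⪯ G ⪯ ηA`. -/
theorem sr1_loewner_bounds {n : ℕ} (A G : Matrix (Fin n) (Fin n) ℝ)
    (hA : A.PosDef) (hG : G.PosDef) (η : ℝ) (hη : 1 ≤ η)
    (hAG : (G - A).PosSemidef) (hGηA : (η • A - G).PosSemidef)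
    (u : Fin n → ℝ) :
    (SR1 A G u - A).PosSemidef ∧ (G - SR1 A G u).PosSemidef ∧
      (η • A - G).PosSemidef := by
  refine ⟨?_, ?_, hGηA⟩ <;> unfold SR1 <;> split_ifs
  · exact hAG
  · rw [sub_right_comm]
    exact hAG.sub_inv_smul_vecMulVec_mulVec u
  · simpa using Matrix.PosSemidef.zero
  · rw [sub_sub_cancel]
    exact hAG.inv_smul_vecMulVec_mulVec u
end

section
/- Let A and G be n×n symmetric real matrices with A positive definite, A ⪯ G, and let u ∈ ℝⁿ satisfy uᵀ(G−A)u > 0. Then tr(SR1(A,G,u) − A) ≤ (1 − λ_min(G−A)/(∑_{i=1}^r λ_i(G−A))) · tr(G − A), where r is the rank of G − A, λ_1(G−A) ≥ ⋯ ≥ λ_r(G−A) are the nonzero eigenvalues of G − A, and λ_min(G−A) is the smallest nonzero eigenvalue of G − A. -/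
open Matrix

/-- The list of eigenvalues (with multiplicity) of a real symmetric matrix. -/
noncomputable def eigList {n : ℕ} (B : Matrix (Fin n) (Fin n) ℝ) : List ℝ :=
  if h : B.IsHermitian then List.ofFn h.eigenvalues else []

/-- The smallest nonzero eigenvalue of a matrix. -/
noncomputable def minNzEig {n : ℕ} (B : Matrix (Fin n) (Fin n) ℝ) : ℝ :=
  sInf {c : ℝ | c ∈ spectrum ℝ B ∧ c ≠ 0}

open scoped MatrixOrder in
theorem Matrix.PosSemidef.minNzEig_mul_dotProduct_le {n : ℕ} {B : Matrix (Fin n) (Fin n) ℝ}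
    (hB : B.PosSemidef) (u : Fin n → ℝ) :
    minNzEig B * (u ⬝ᵥ (B *ᵥ u)) ≤ (B *ᵥ u) ⬝ᵥ (B *ᵥ u) := by
  have hsa : IsSelfAdjoint B := hB.isHermitian
  have hnonneg : ∀ x ∈ spectrum ℝ B, 0 ≤ x := fun x hx =>
    spectrum_nonneg_of_nonneg (Matrix.nonneg_iff_posSemidef.mpr hB) hx
  have hf : ∀ x ∈ spectrum ℝ B, 0 ≤ x * x - minNzEig B * x := by
    intro x hx
    rcases eq_or_ne x 0 with rfl | h0
    · simp
    · have hmin : minNzEig B ≤ x := csInf_le ⟨0, fun y hy => hnonneg y hy.1⟩ ⟨hx, h0⟩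
      nlinarith [hnonneg x hx]
  have hcfc : cfc (fun x : ℝ => x * x - minNzEig B * x) B = B * B - minNzEig B • B := by
    rw [cfc_sub (fun x : ℝ => x * x) (fun x => minNzEig B * x) B,
      cfc_mul (fun x : ℝ => x) (fun x => x) B, cfc_const_mul_id _ B, cfc_id' ℝ B]
  have hpos : (B * B - minNzEig B • B).PosSemidef := by
    rw [← Matrix.nonneg_iff_posSemidef, ← hcfc]
    exact cfc_nonneg hf
  have h := hpos.dotProduct_mulVec_nonneg u
  have hT : Bᵀ = B := by simpa [Matrix.IsHermitian] using hB.isHermitian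
  have hsq : u ⬝ᵥ (B *ᵥ (B *ᵥ u)) = (B *ᵥ u) ⬝ᵥ (B *ᵥ u) := by
    rw [Matrix.dotProduct_mulVec, ← Matrix.mulVec_transpose, hT]
  simp only [star_trivial, Matrix.sub_mulVec, Matrix.smul_mulVec, dotProduct_sub,
    dotProduct_smul, ← Matrix.mulVec_mulVec, hsq, smul_eq_mul] at h
  linarith

theorem List.sum_filter_ne_zero (l : List ℝ) : (l.filter (fun c => c ≠ 0)).sum = l.sum := by
  induction l with
  | nil => simp
  | cons a l ih => by_cases h : a = 0 <;> simp_all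

theorem Matrix.IsHermitian.sum_filter_eigList {n : ℕ} {B : Matrix (Fin n) (Fin n) ℝ}
    (hB : B.IsHermitian) : ((eigList B).filter (fun c => c ≠ 0)).sum = B.trace := by
  rw [List.sum_filter_ne_zero, eigList, dif_pos hB, List.sum_ofFn,
    hB.trace_eq_sum_eigenvalues]
  simp

/-- Lemma 2.2: trace-potential decrease of the SR1 update.  The denominator
`∑_{i=1}^r λ_i(G−A)` is the sum of the nonzero eigenvalues of `G − A`. -/
theorem sr1_trace_decrease {n : ℕ} (A G : Matrix (Fin n) (Fin n) ℝ)
    (hA : A.PosDef) (hG : G.IsHermitian) (hAG : (G - A).PosSemidef)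
    (u : Fin n → ℝ) (hu : 0 < u ⬝ᵥ ((G - A) *ᵥ u)) :
    (SR1 A G u - A).trace ≤
      (1 - minNzEig (G - A) / ((eigList (G - A)).filter (fun c => c ≠ 0)).sum) *
        (G - A).trace := by
  have hB0 : (G - A) *ᵥ u ≠ 0 := fun h => by simp [h] at hu
  have htr : (G - A).trace ≠ 0 := fun h => hB0 <| by
    rw [hAG.trace_eq_zero_iff.mp h, Matrix.zero_mulVec]
  have hle := hAG.minNzEig_mul_dotProduct_le u
  rw [hAG.isHermitian.sum_filter_eigList, one_sub_mul, div_mul_cancel₀ _ htr, SR1, if_neg hB0,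
    sub_right_comm, Matrix.trace_sub (G - A), Matrix.trace_smul, Matrix.trace_vecMulVec,
    smul_eq_mul, inv_mul_eq_div]
  exact sub_le_sub_left ((le_div_iff₀ hu).mpr hle) _
end

section
/- Let A and G be n×n symmetric real matrices with A ⪯ G, and let u ∈ ℝⁿ satisfy uᵀ(G−A)u > 0. Then rank(SR1(A,G,u) − A) = rank(G − A) − 1. -/
open Matrix

/-- The null space of the Wedderburn rank reduction of `M` along `u` and `v`. -/
theorem Matrix.ker_mulVecLin_sub_vecMulVec {m n K : Type*} [Fintype m] [Fintype n] [Field K]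
    (M : Matrix m n K) (v : m → K) (u : n → K) (h : v ⬝ᵥ (M *ᵥ u) ≠ 0) :
    LinearMap.ker (M - (v ⬝ᵥ (M *ᵥ u))⁻¹ • vecMulVec (M *ᵥ u) (v ᵥ* M)).mulVecLin =
      LinearMap.ker M.mulVecLin ⊔ Submodule.span K {u} := by
  have key (x : n → K) :
      (M - (v ⬝ᵥ (M *ᵥ u))⁻¹ • vecMulVec (M *ᵥ u) (v ᵥ* M)) *ᵥ x =
        M *ᵥ x - ((v ⬝ᵥ (M *ᵥ u))⁻¹ * (v ⬝ᵥ (M *ᵥ x))) • (M *ᵥ u) := by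
    rw [sub_mulVec, smul_mulVec, vecMulVec_mulVec, ← dotProduct_mulVec, op_smul_eq_smul, smul_smul]
  apply le_antisymm
  · intro x hx
    rw [LinearMap.mem_ker, mulVecLin_apply, key, ← mulVec_smul, ← mulVec_sub] at hx
    rw [← sub_add_cancel x (((v ⬝ᵥ (M *ᵥ u))⁻¹ * (v ⬝ᵥ (M *ᵥ x))) • u)]
    exact Submodule.add_mem_sup hx
      (Submodule.smul_mem _ _ (Submodule.mem_span_singleton_self u))
  · rw [sup_le_iff, Submodule.span_singleton_le_iff_mem]
    constructor
    · intro x hx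
      rw [LinearMap.mem_ker, mulVecLin_apply] at hx ⊢
      simp [key, hx]
    · rw [LinearMap.mem_ker, mulVecLin_apply, key, inv_mul_cancel₀ h, one_smul, sub_self]

/-- Wedderburn rank reduction: subtracting a suitable rank-one matrix lowers the rank by one. -/
theorem Matrix.rank_sub_vecMulVec_add_one {m n K : Type*} [Fintype m] [Fintype n] [Field K]
    (M : Matrix m n K) (v : m → K) (u : n → K) (h : v ⬝ᵥ (M *ᵥ u) ≠ 0) :
    (M - (v ⬝ᵥ (M *ᵥ u))⁻¹ • vecMulVec (M *ᵥ u) (v ᵥ* M)).rank + 1 = M.rank := by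
  have hu : u ∉ LinearMap.ker M.mulVecLin := fun hu ↦ by
    rw [LinearMap.mem_ker, mulVecLin_apply] at hu
    simp [hu] at h
  have hu₀ : u ≠ 0 := fun h₀ ↦ hu (h₀ ▸ Submodule.zero_mem _)
  have hsup := Submodule.finrank_sup_add_finrank_inf_eq
    (LinearMap.ker M.mulVecLin) (Submodule.span K {u})
  rw [((Submodule.disjoint_span_singleton' hu₀).2 hu).eq_bot, finrank_bot, finrank_span_singleton hu₀,
    ← M.ker_mulVecLin_sub_vecMulVec v u h] at hsup
  have h₁ := M.mulVecLin.finrank_range_add_finrank_ker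
  have h₂ := (M - (v ⬝ᵥ (M *ᵥ u))⁻¹ •
    vecMulVec (M *ᵥ u) (v ᵥ* M)).mulVecLin.finrank_range_add_finrank_ker
  unfold Matrix.rank
  omega

/-- Lemma 2.3 (first part): the SR1 update decreases the rank of `G − A` by one. -/
theorem sr1_rank_decrease {n : ℕ} (A G : Matrix (Fin n) (Fin n) ℝ)
    (hA : A.IsHermitian) (hG : G.IsHermitian) (hAG : (G - A).PosSemidef)
    (u : Fin n → ℝ) (hu : 0 < u ⬝ᵥ ((G - A) *ᵥ u)) :
    (SR1 A G u - A).rank = (G - A).rank - 1 := by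
  have hM : (G - A)ᵀ = G - A := by
    simpa [conjTranspose_eq_transpose_of_trivial] using hAG.isHermitian.eq
  have hne : (G - A) *ᵥ u ≠ 0 := fun h ↦ by simp [h] at hu
  have key := (G - A).rank_sub_vecMulVec_add_one u u hu.ne'
  rw [← mulVec_transpose, hM] at key
  rw [SR1, if_neg hne, sub_right_comm]
  omega
end

section
/- Let A and G be n×n symmetric real matrices with A ⪯ G, and let u ∈ ℝⁿ satisfy uᵀ(G−A)u > 0. Then κ(SR1(A,G,u) − A) ≤ κ(G − A), where for a nonzero positive semidefinite matrix B, κ(B) denotes the ratio λ_max(B)/λ_min(B) of the largest eigenvalue of B to the smallest nonzero eigenvalue of B. -/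
open Matrix

/-- The largest eigenvalue of a matrix. -/
noncomputable def maxEig {n : ℕ} (B : Matrix (Fin n) (Fin n) ℝ) : ℝ :=
  sSup (spectrum ℝ B)

/-- The condition number κ(B) = λ_max(B)/λ_min(B), with λ_min the smallest
nonzero eigenvalue. -/
noncomputable def condNum {n : ℕ} (B : Matrix (Fin n) (Fin n) ℝ) : ℝ :=
  maxEig B / minNzEig B

/-- A nonnegative quadratic polynomial without constant term on the spectrum of a symmetric matrix
gives a nonnegative quadratic form. -/
theorem quadratic_form_nonneg_of_spectrum {n : ℕ} {R : Matrix (Fin n) (Fin n) ℝ}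
    (hR : R.IsHermitian) {a b : ℝ} (h : ∀ t ∈ spectrum ℝ R, 0 ≤ a * (t * t) + b * t)
    (x : Fin n → ℝ) :
    0 ≤ a * ((R *ᵥ x) ⬝ᵥ (R *ᵥ x)) + b * (x ⬝ᵥ (R *ᵥ x)) := by
  have hpsd : (a • (R * R) + b • R).PosSemidef := by
    let U : Matrix (Fin n) (Fin n) ℝ := hR.eigenvectorUnitary
    let D : Matrix (Fin n) (Fin n) ℝ := diagonal hR.eigenvalues
    have hRU : R = U * D * Uᴴ := by
      simpa [Unitary.conjStarAlgAut_apply, Function.comp_def, U, D, star_eq_conjTranspose] using hR.spectral_theorem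
    have hU : Uᴴ * U = 1 := Unitary.coe_star_mul_self hR.eigenvectorUnitary
    have hRR : R * R = U * (D * D) * Uᴴ := by
      calc R * R = (U * D * Uᴴ) * (U * D * Uᴴ) := by rw [← hRU]
        _ = U * D * (Uᴴ * U) * D * Uᴴ := by simp only [Matrix.mul_assoc]
        _ = U * (D * D) * Uᴴ := by simp only [hU, Matrix.mul_assoc, Matrix.mul_one]
    have hsum : a • (R * R) + b • R = U * (a • (D * D) + b • D) * Uᴴ := by
      rw [hRR]
      nth_rewrite 1 [hRU]
      simp only [Matrix.mul_add, Matrix.add_mul, Matrix.mul_smul, Matrix.smul_mul]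
    rw [hsum]
    refine PosSemidef.mul_mul_conjTranspose_same ?_ U
    have hD : a • (D * D) + b • D =
        diagonal fun i => a * (hR.eigenvalues i * hR.eigenvalues i) + b * hR.eigenvalues i := by
      simp only [D, diagonal_mul_diagonal, ← diagonal_smul, diagonal_add]
      rfl
    rw [hD]
    exact PosSemidef.diagonal fun i => h _ (hR.eigenvalues_mem_spectrum_real i)
  have hx := hpsd.dotProduct_mulVec_nonneg x
  have hRT : Rᵀ = R := by simpa using hR.eq
  have hsymm : x ⬝ᵥ (R *ᵥ (R *ᵥ x)) = (R *ᵥ x) ⬝ᵥ (R *ᵥ x) := by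
    rw [dotProduct_mulVec, ← mulVec_transpose, hRT]
  simpa [add_mulVec, smul_mulVec, ← mulVec_mulVec, hsymm] using hx

/-- Real spectral values of a real matrix have real eigenvectors. -/
theorem exists_mulVec_eq_smul_of_mem_spectrum {n : ℕ} {B : Matrix (Fin n) (Fin n) ℝ} {μ : ℝ}
    (hμ : μ ∈ spectrum ℝ B) : ∃ v ≠ 0, B *ᵥ v = μ • v := by
  rw [spectrum.mem_iff, isUnit_iff_isUnit_det, isUnit_iff_ne_zero, not_not,
    ← exists_mulVec_eq_zero_iff] at hμ
  obtain ⟨v, hv, hBv⟩ := hμ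
  refine ⟨v, hv, ?_⟩
  rw [sub_mulVec, sub_eq_zero, Algebra.algebraMap_eq_smul_one, smul_mulVec, one_mulVec] at hBv
  exact hBv.symm

/-- A nonzero spectral value of the rank-one deflation `R - R u uᵀ R / (uᵀ R u)` comes with a
vector `x` whose image `R x` is a corresponding eigenvector. -/
theorem exists_preimage_of_mem_spectrum_deflation {n : ℕ} {R : Matrix (Fin n) (Fin n) ℝ}
    (hR : R.IsHermitian) {u : Fin n → ℝ} (hu : u ⬝ᵥ (R *ᵥ u) ≠ 0) {μ : ℝ} (hμ0 : μ ≠ 0)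
    (hμ : μ ∈ spectrum ℝ (R - (u ⬝ᵥ (R *ᵥ u))⁻¹ • vecMulVec (R *ᵥ u) (R *ᵥ u))) :
    ∃ x q, 0 < q ∧ (R *ᵥ x) ⬝ᵥ (R *ᵥ x) = μ * μ * q ∧ x ⬝ᵥ (R *ᵥ x) = μ * q := by
  obtain ⟨v, hv, hBv⟩ := exists_mulVec_eq_smul_of_mem_spectrum hμ
  have hRT : Rᵀ = R := by simpa using hR.eq
  set c := u ⬝ᵥ (R *ᵥ u)
  set x := v - (c⁻¹ * ((R *ᵥ u) ⬝ᵥ v)) • u with hx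
  have hRx : R *ᵥ x = μ • v := by
    rw [← hBv, hx, mulVec_sub, mulVec_smul, sub_mulVec, smul_mulVec, vecMulVec_mulVec]
    ext i
    simp
    ring
  have huR : u ⬝ᵥ (R *ᵥ v) = (R *ᵥ u) ⬝ᵥ v := by
    rw [dotProduct_mulVec, ← mulVec_transpose, hRT]
  have huv : u ⬝ᵥ v = 0 := by
    have h1 : u ⬝ᵥ (R *ᵥ x) = 0 := by
      rw [hx, mulVec_sub, mulVec_smul, dotProduct_sub, dotProduct_smul, huR, smul_eq_mul]
      change _ - _ * c = 0
      field_simp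
      ring
    rw [hRx, dotProduct_smul, smul_eq_mul] at h1
    exact (mul_eq_zero.mp h1).resolve_left hμ0
  refine ⟨x, v ⬝ᵥ v, ?_, ?_, ?_⟩
  · exact (Finset.sum_nonneg fun i _ => mul_self_nonneg (v i)).lt_of_ne'
      (fun h => hv (dotProduct_self_eq_zero.mp h))
  · rw [hRx]
    simp [mul_assoc]
  · rw [hRx, hx]
    simp [sub_dotProduct, huv]

/-- Lemma 2.3 (second part): the SR1 update does not increase the condition
number of `G − A`. -/
theorem sr1_cond_nonincreasing {n : ℕ} (A G : Matrix (Fin n) (Fin n) ℝ)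
    (hA : A.IsHermitian) (hG : G.IsHermitian) (hAG : (G - A).PosSemidef)
    (u : Fin n → ℝ) (hu : 0 < u ⬝ᵥ ((G - A) *ᵥ u)) :
    condNum (SR1 A G u - A) ≤ condNum (G - A) := by
  set R := G - A with hRdef
  set B := R - (u ⬝ᵥ (R *ᵥ u))⁻¹ • vecMulVec (R *ᵥ u) (R *ᵥ u) with hBdef
  have hRu : R *ᵥ u ≠ 0 := fun h => by simp [h] at hu
  have hB : SR1 A G u - A = B := by
    rw [SR1, if_neg hRu, hBdef, hRdef]
    abel
  rw [hB]
  have hnonneg : ∀ t ∈ spectrum ℝ R, 0 ≤ t := by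
    intro t ht
    rw [hAG.1.spectrum_real_eq_range_eigenvalues] at ht
    obtain ⟨i, rfl⟩ := ht
    exact hAG.eigenvalues_nonneg i
  have hbdd : BddAbove (spectrum ℝ R) := R.finite_real_spectrum.bddAbove
  have hbdd' : BddBelow {c : ℝ | c ∈ spectrum ℝ R ∧ c ≠ 0} := ⟨0, fun t ht => hnonneg t ht.1⟩
  have hmax : 0 ≤ maxEig R := Real.sSup_nonneg hnonneg
  have hmin : 0 ≤ minNzEig R := Real.sInf_nonneg fun t ht => hnonneg t ht.1
  have hbounds : ∀ μ ∈ spectrum ℝ B, μ ≠ 0 → 0 < μ ∧ minNzEig R ≤ μ ∧ μ ≤ maxEig R := by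
    intro μ hμ hμ0
    obtain ⟨x, q, hq, hxx, hx⟩ :=
      exists_preimage_of_mem_spectrum_deflation hAG.1 hu.ne' hμ0 hμ
    have hpos : 0 < μ := by
      have h1 : 0 ≤ μ * q := hx ▸ hAG.dotProduct_mulVec_nonneg x
      exact (nonneg_of_mul_nonneg_left h1 hq).lt_of_ne' hμ0
    have hlow := quadratic_form_nonneg_of_spectrum hAG.1 (a := 1) (b := -minNzEig R) (fun t ht => by
      rcases eq_or_ne t 0 with rfl | ht0
      · simp
      · have h1 : minNzEig R ≤ t := csInf_le hbdd' ⟨ht, ht0⟩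
        nlinarith [hnonneg t ht]) x
    have hupp := quadratic_form_nonneg_of_spectrum hAG.1 (a := -1) (b := maxEig R) (fun t ht => by
      have h1 : t ≤ maxEig R := le_csSup hbdd ht
      nlinarith [hnonneg t ht]) x
    rw [hxx, hx] at hlow hupp
    have hμq : 0 < μ * q := mul_pos hpos hq
    refine ⟨hpos, ?_, ?_⟩
    · refine le_of_mul_le_mul_right ?_ hμq
      linarith
    · refine le_of_mul_le_mul_right ?_ hμq
      linarith
  by_cases hne : ∃ μ ∈ spectrum ℝ B, μ ≠ 0
  · obtain ⟨μ, hμ, hμ0⟩ := hne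
    obtain ⟨hpos, -, hle⟩ := hbounds μ hμ hμ0
    have hM : 0 < maxEig R := hpos.trans_le hle
    have hRne : {c : ℝ | c ∈ spectrum ℝ R ∧ c ≠ 0}.Nonempty := by
      by_contra! hempty
      refine hM.not_ge (Real.sSup_nonpos fun t ht => ?_)
      by_contra! ht0
      exact (hempty ▸ (⟨ht, ht0.ne'⟩ : t ∈ {c : ℝ | c ∈ spectrum ℝ R ∧ c ≠ 0}) :
        t ∈ (∅ : Set ℝ))
    have hminpos : 0 < minNzEig R := by
      have hmem := hRne.csInf_mem (R.finite_real_spectrum.subset fun t ht => ht.1)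
      exact hmin.lt_of_ne' hmem.2
    refine div_le_div₀ hmax ?_ hminpos ?_
    · refine Real.sSup_le (fun t ht => ?_) hmax
      rcases eq_or_ne t 0 with rfl | ht0
      · exact hmax
      · exact (hbounds t ht ht0).2.2
    · exact le_csInf ⟨μ, hμ, hμ0⟩ fun t ht => (hbounds t ht.1 ht.2).2.1
  · have hempty : {c : ℝ | c ∈ spectrum ℝ B ∧ c ≠ 0} = ∅ := by
      ext t
      simpa using fun ht => not_not.mp fun ht0 => hne ⟨t, ht, ht0⟩
    have hzero : minNzEig B = 0 := by rw [minNzEig, hempty, Real.sInf_empty]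
    rw [condNum, hzero, div_zero]
    exact div_nonneg hmax hmin
end

section
/- Let A and G be n×n symmetric positive definite real matrices with G ⪰ A, and let u ∈ ℝⁿ with (G−A)u ≠ 0. Then the inverse of G₊ = SR1(A,G,u) satisfies G₊⁻¹ = G⁻¹ + ((I − G⁻¹A)uuᵀ(I − AG⁻¹))/(uᵀ(A − AG⁻¹A)u). -/
open Matrix

/-- Symmetric Sherman–Morrison formula, phrased with `p = G⁻¹ v`. -/
theorem inv_sub_smul_vecMulVec_self {n : ℕ} {G : Matrix (Fin n) (Fin n) ℝ} (hG : G.PosDef)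
    {v p : Fin n → ℝ} {d s : ℝ} (hd : d ≠ 0) (hs : s ≠ 0) (hp : G *ᵥ p = v)
    (hvp : v ⬝ᵥ p = d - s) :
    (G - d⁻¹ • vecMulVec v v)⁻¹ = G⁻¹ + s⁻¹ • vecMulVec p p := by
  have hdet : IsUnit G.det := (Matrix.isUnit_iff_isUnit_det G).1 hG.isUnit
  have hGt : Gᵀ = G := by simpa using hG.isHermitian.eq
  have hv : v ᵥ* G⁻¹ = p := by
    rw [← hp, ← vecMul_transpose, hGt, vecMul_vecMul, mul_nonsing_inv _ hdet, vecMul_one]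
  apply inv_eq_right_inv
  rw [sub_mul, mul_add, mul_add, mul_nonsing_inv _ hdet, mul_smul_comm, smul_mul_assoc,
    smul_mul_assoc, mul_smul_comm, vecMulVec_mul, hv, mul_vecMulVec, hp,
    vecMulVec_mul_vecMulVec, hvp]
  ext i j
  simp only [Matrix.sub_apply, Matrix.add_apply, Matrix.smul_apply, vecMulVec_apply, smul_eq_mul, Pi.smul_apply]
  field_simp
  ring

/-- The inverse update formula for SR1:
`G₊⁻¹ = G⁻¹ + (I − G⁻¹A)uuᵀ(I − AG⁻¹) / (uᵀ(A − AG⁻¹A)u)`. -/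
theorem sr1_inverse_update {n : ℕ} (A G : Matrix (Fin n) (Fin n) ℝ)
    (hA : A.PosDef) (hG : G.PosDef) (hAG : (G - A).PosSemidef)
    (u : Fin n → ℝ) (hu : (G - A) *ᵥ u ≠ 0) :
    (SR1 A G u)⁻¹ =
      G⁻¹ + (u ⬝ᵥ ((A - A * G⁻¹ * A) *ᵥ u))⁻¹ •
        Matrix.vecMulVec ((1 - G⁻¹ * A) *ᵥ u) (Matrix.vecMul u (1 - A * G⁻¹)) := by
  have hdet : IsUnit G.det := (Matrix.isUnit_iff_isUnit_det G).1 hG.isUnit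
  have hGt : Gᵀ = G := by simpa using hG.isHermitian.eq
  have hAt : Aᵀ = A := by simpa using hA.isHermitian.eq
  have symm_form {M : Matrix (Fin n) (Fin n) ℝ} (hM : Mᵀ = M) (x z : Fin n → ℝ) :
      x ⬝ᵥ (M *ᵥ z) = z ⬝ᵥ (M *ᵥ x) := by
    rw [dotProduct_mulVec, dotProduct_comm, ← mulVec_transpose, hM]
  obtain ⟨y, hy⟩ : ∃ y, y = (G⁻¹ * A) *ᵥ u := ⟨_, rfl⟩
  have hGy : G *ᵥ y = A *ᵥ u := by
    rw [hy, mulVec_mulVec, mul_nonsing_inv_cancel_left _ _ hdet]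
  have hp : (1 - G⁻¹ * A) *ᵥ u = u - y := by rw [sub_mulVec, one_mulVec, hy]
  have hp' : u ᵥ* (1 - A * G⁻¹) = u - y := by
    rw [← hp, ← mulVec_transpose, transpose_sub, transpose_one, transpose_mul,
      transpose_nonsing_inv, hGt, hAt]
  have hs : u ⬝ᵥ ((A - A * G⁻¹ * A) *ᵥ u) = u ⬝ᵥ (A *ᵥ u) - u ⬝ᵥ (A *ᵥ y) := by
    rw [sub_mulVec, dotProduct_sub, hy, mulVec_mulVec, mul_assoc]
  have hGp : G *ᵥ (u - y) = (G - A) *ᵥ u := by rw [mulVec_sub, hGy, sub_mulVec]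
  have hne : u - y ≠ 0 := by
    intro h
    rw [h, mulVec_zero] at hGp
    exact hu hGp.symm
  have hAuy := symm_form hAt u y
  have hs_pos : 0 < u ⬝ᵥ ((A - A * G⁻¹ * A) *ᵥ u) := by
    have h1 := hA.dotProduct_mulVec_pos hne
    have h2 := hAG.dotProduct_mulVec_nonneg y
    simp only [star_trivial, mulVec_sub, sub_mulVec, sub_dotProduct, dotProduct_sub, hGy] at h1 h2
    rw [hs]
    linarith
  have hd : u ⬝ᵥ ((G - A) *ᵥ u) ≠ 0 := by
    intro h
    exact hu ((hAG.dotProduct_mulVec_zero_iff u).1 (by simpa using h))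
  rw [SR1, if_neg hu, hp, hp']
  refine inv_sub_smul_vecMulVec_self hG hd hs_pos.ne' hGp ?_
  rw [dotProduct_comm, hs]
  simp only [sub_mulVec, dotProduct_sub, sub_dotProduct]
  rw [symm_form hGt y u, hGy]
  linarith
end

section
/- Let A and G be n×n symmetric positive definite real matrices with G ⪰ A ≻ 0. Then for any u ∈ ℝⁿ \ {0} with (G−A)u ≠ 0, one has V(A,G) − V(A, SR1(A,G,u)) = ln(1 + ν(A,G,u)²), where ν(A,G,u) = (uᵀ(G−A)G⁻¹(G−A)u / uᵀ(A − AG⁻¹A)u)^{1/2}. -/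
open Matrix

/-- The matrix determinant lemma for a rank-one subtraction. -/
theorem det_sub_smul_vecMulVec {m R : Type*} [Fintype m] [DecidableEq m] [CommRing R]
    {G : Matrix m m R} (hG : IsUnit G.det) (c : R) (v w : m → R) :
    (G - c • vecMulVec v w).det = G.det * (1 - c * (w ⬝ᵥ (G⁻¹ *ᵥ v))) := by
  have h := det_add_replicateCol_mul_replicateRow (ι := Unit) hG (-c • v) w
  rw [← vecMulVec_eq Unit, smul_vecMulVec, neg_smul, ← sub_eq_add_neg] at h
  rw [h, det_unique (n := Unit)]
  congr 1
  rw [Matrix.mul_assoc, ← replicateCol_mulVec, Matrix.add_apply, one_apply_eq,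
    replicateRow_mul_replicateCol_apply, mulVec_smul,
    dotProduct_smul, smul_eq_mul, neg_mul, sub_eq_add_neg]

/-- For `0 ≺ A ⪯ G`, the `G⁻¹`-energy of `(G - A) u` is strictly below the curvature
`uᵀ (G - A) u`. -/
theorem dotProduct_inv_mulVec_sub_lt {m : Type*} [Fintype m] [DecidableEq m]
    {A G : Matrix m m ℝ} (hA : A.PosDef) (hG : IsUnit G.det) (hAG : (G - A).PosSemidef)
    {u : m → ℝ} (hu : (G - A) *ᵥ u ≠ 0) :
    ((G - A) *ᵥ u) ⬝ᵥ (G⁻¹ *ᵥ ((G - A) *ᵥ u)) < u ⬝ᵥ ((G - A) *ᵥ u) := by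
  set w := (G - A) *ᵥ u with hw
  set z := G⁻¹ *ᵥ w with hz
  have hGz : G *ᵥ z = w := by rw [hz, mulVec_mulVec, mul_nonsing_inv _ hG, one_mulVec]
  have hz0 : z ≠ 0 := fun h => hu (by rw [← hGz, h, mulVec_zero])
  have hAz : 0 < z ⬝ᵥ (A *ᵥ z) := by simpa using hA.dotProduct_mulVec_pos hz0
  have hsq : 0 ≤ (u - z) ⬝ᵥ ((G - A) *ᵥ (u - z)) := by
    simpa using hAG.dotProduct_mulVec_nonneg (u - z)
  have hsymm : u ⬝ᵥ ((G - A) *ᵥ z) = w ⬝ᵥ z := by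
    have hT : (G - A)ᵀ = G - A := hAG.isHermitian
    rw [dotProduct_mulVec, ← mulVec_transpose, hT]
  have hzz : z ⬝ᵥ ((G - A) *ᵥ z) = w ⬝ᵥ z - z ⬝ᵥ (A *ᵥ z) := by
    rw [sub_mulVec, hGz, dotProduct_sub, dotProduct_comm z w]
  rw [mulVec_sub, ← hw, sub_dotProduct, dotProduct_sub, dotProduct_sub, hsymm, hzz,
    dotProduct_comm z w] at hsq
  linarith

/-- Lemma 2.4: the decrease of the potential `V(A,G) = ln det(GA⁻¹)` under an
SR1 update equals `ln(1 + ν(A,G,u)²)`. -/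
theorem sr1_logdet_potential_decrease {n : ℕ} (A G : Matrix (Fin n) (Fin n) ℝ)
    (hA : A.PosDef) (hG : G.PosDef) (hAG : (G - A).PosSemidef)
    (u : Fin n → ℝ) (hu0 : u ≠ 0) (hu : (G - A) *ᵥ u ≠ 0) :
    Real.log (G * A⁻¹).det - Real.log ((SR1 A G u) * A⁻¹).det =
      Real.log (1 +
        (u ⬝ᵥ (((G - A) * G⁻¹ * (G - A)) *ᵥ u)) /
          (u ⬝ᵥ ((A - A * G⁻¹ * A) *ᵥ u))) := by
  have hGu : IsUnit G.det := hG.det_pos.ne'.isUnit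
  have hT : (G - A)ᵀ = G - A := hAG.isHermitian
  have hlt := dotProduct_inv_mulVec_sub_lt hA hGu hAG hu
  have hquad : u ⬝ᵥ (((G - A) * G⁻¹ * (G - A)) *ᵥ u) =
      ((G - A) *ᵥ u) ⬝ᵥ (G⁻¹ *ᵥ ((G - A) *ᵥ u)) := by
    rw [← mulVec_mulVec, ← mulVec_mulVec, dotProduct_mulVec, ← mulVec_transpose, hT]
  have hdiff : A - A * G⁻¹ * A = (G - A) - (G - A) * G⁻¹ * (G - A) := by
    simp only [sub_mul, mul_sub, mul_nonsing_inv _ hGu, Matrix.one_mul,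
      Matrix.mul_assoc, nonsing_inv_mul _ hGu, Matrix.mul_one]
    abel
  rw [hdiff, sub_mulVec, dotProduct_sub, hquad, det_mul, det_mul, SR1, if_neg hu,
    det_sub_smul_vecMulVec hGu]
  have htpos : 0 ≤ ((G - A) *ᵥ u) ⬝ᵥ (G⁻¹ *ᵥ ((G - A) *ᵥ u)) := by
    simpa using hG.inv.posSemidef.dotProduct_mulVec_nonneg ((G - A) *ᵥ u)
  generalize u ⬝ᵥ ((G - A) *ᵥ u) = s at *
  generalize ((G - A) *ᵥ u) ⬝ᵥ (G⁻¹ *ᵥ ((G - A) *ᵥ u)) = t at *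
  have hs : s ≠ 0 := (htpos.trans_lt hlt).ne'
  have hst : s - t ≠ 0 := (sub_pos.mpr hlt).ne'
  have hfac : 1 - s⁻¹ * t ≠ 0 := by
    rw [show 1 - s⁻¹ * t = (s - t) / s by field_simp]
    exact div_ne_zero hst hs
  have hAi : (A⁻¹).det ≠ 0 := hA.inv.det_pos.ne'
  have hGd : G.det ≠ 0 := hG.det_pos.ne'
  rw [← Real.log_div (mul_ne_zero hGd hAi) (mul_ne_zero (mul_ne_zero hGd hfac) hAi)]
  congr 1
  rw [show 1 - s⁻¹ * t = (s - t) / s by field_simp]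
  field_simp
  ring
end

section
/- Let A and G be n×n symmetric positive definite real matrices with G ⪰ A, and let u ∈ ℝⁿ \ {0} with (G−A)u ≠ 0 and u ∉ ker(G). Then ν(A,G,u)² ≥ (uᵀ(G−A)G₊⁻¹(G−A)u)/(uᵀGu), where G₊ = SR1(A,G,u) and ν(A,G,u) = (uᵀ(G−A)G⁻¹(G−A)u / uᵀ(A − AG⁻¹A)u)^{1/2}. -/
open Matrix

/-- A symmetric matrix can be moved across the dot product. -/
theorem Matrix.IsSymm.dotProduct_mulVec_comm {n : ℕ} {M : Matrix (Fin n) (Fin n) ℝ}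
    (hM : M.IsSymm) (x y : Fin n → ℝ) : x ⬝ᵥ (M *ᵥ y) = (M *ᵥ x) ⬝ᵥ y := by
  rw [dotProduct_mulVec, ← mulVec_transpose, hM.eq]

/-- The quadratic form of a positive definite matrix is positive away from zero. -/
theorem Matrix.PosDef.dotProduct_mulVec_self_pos {n : ℕ} {M : Matrix (Fin n) (Fin n) ℝ}
    (hM : M.PosDef) {x : Fin n → ℝ} (hx : x ≠ 0) : 0 < x ⬝ᵥ (M *ᵥ x) := by
  simpa using hM.dotProduct_mulVec_pos hx

/-- The quadratic form of a positive semidefinite matrix is nonnegative. -/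
theorem Matrix.PosSemidef.dotProduct_mulVec_self_nonneg {n : ℕ} {M : Matrix (Fin n) (Fin n) ℝ}
    (hM : M.PosSemidef) (x : Fin n → ℝ) : 0 ≤ x ⬝ᵥ (M *ᵥ x) := by
  simpa using hM.dotProduct_mulVec_nonneg x

/-- If `G w = v` and `vᵀ w ≠ s`, then `G - s⁻¹ v vᵀ` is invertible and its inverse
sends `v` to `(s / (s - vᵀ w)) w`. -/
theorem inv_sub_smul_vecMulVec_mulVec {n : ℕ} {G : Matrix (Fin n) (Fin n) ℝ}
    (hG : IsUnit G.det) {v w : Fin n → ℝ} {s : ℝ} (hw : G *ᵥ w = v) (hs : s ≠ 0)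
    (hsw : s - v ⬝ᵥ w ≠ 0) :
    (G - s⁻¹ • vecMulVec v v)⁻¹ *ᵥ v = (s / (s - v ⬝ᵥ w)) • w := by
  have hmul : ∀ y, (G - s⁻¹ • vecMulVec v v) *ᵥ y = G *ᵥ y - (s⁻¹ * (v ⬝ᵥ y)) • v := by
    intro y
    rw [sub_mulVec, smul_mulVec, vecMulVec_mulVec, op_smul_eq_smul, smul_smul]
  have hinj : Function.Injective (G *ᵥ ·) :=
    mulVec_injective_of_isUnit ((isUnit_iff_isUnit_det G).2 hG)
  have hdet : IsUnit (G - s⁻¹ • vecMulVec v v).det := by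
    rw [isUnit_iff_ne_zero]
    intro h0
    obtain ⟨y, hy0, hy⟩ := exists_mulVec_eq_zero_iff.2 h0
    rw [hmul, sub_eq_zero] at hy
    have hyw : y = (s⁻¹ * (v ⬝ᵥ y)) • w := by
      apply hinj
      simp only [mulVec_smul, hw, hy]
    have hvy : v ⬝ᵥ y = s⁻¹ * (v ⬝ᵥ y) * (v ⬝ᵥ w) := by
      conv_lhs => rw [hyw, dotProduct_smul, smul_eq_mul]
    have hz : (v ⬝ᵥ y) * (s - v ⬝ᵥ w) = 0 := by
      field_simp at hvy
      linarith
    have hz' : v ⬝ᵥ y = 0 := (mul_eq_zero.1 hz).resolve_right hsw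
    apply hy0
    rw [hyw, hz', mul_zero, zero_smul]
  have hv : (G - s⁻¹ • vecMulVec v v) *ᵥ ((s / (s - v ⬝ᵥ w)) • w) = v := by
    rw [mulVec_smul, hmul, hw]
    ext i
    simp only [Pi.smul_apply, Pi.sub_apply, smul_eq_mul]
    field_simp
  have h := congrArg ((G - s⁻¹ • vecMulVec v v)⁻¹ *ᵥ ·) hv
  simp only [mulVec_mulVec, nonsing_inv_mul _ hdet, one_mulVec] at h
  exact h.symm

/-- Lemma 2.5: `ν(A,G,u)² ≥ uᵀ(G−A)G₊⁻¹(G−A)u / uᵀGu` where `G₊ = SR1(A,G,u)`. -/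
theorem sr1_nu_lower_bound {n : ℕ} (A G : Matrix (Fin n) (Fin n) ℝ)
    (hA : A.PosDef) (hG : G.PosDef) (hAG : (G - A).PosSemidef)
    (u : Fin n → ℝ) (hu0 : u ≠ 0) (hu : (G - A) *ᵥ u ≠ 0)
    (hker : G *ᵥ u ≠ 0) :
    (u ⬝ᵥ (((G - A) * (SR1 A G u)⁻¹ * (G - A)) *ᵥ u)) / (u ⬝ᵥ (G *ᵥ u)) ≤
      (u ⬝ᵥ (((G - A) * G⁻¹ * (G - A)) *ᵥ u)) /
        (u ⬝ᵥ ((A - A * G⁻¹ * A) *ᵥ u)) := by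
  have hdet : IsUnit G.det := hG.det_pos.ne'.isUnit
  have hsymm : (G - A).IsSymm := by
    simpa [IsHermitian, IsSymm] using hAG.isHermitian
  have hS : SR1 A G u = G - (u ⬝ᵥ ((G - A) *ᵥ u))⁻¹ •
      vecMulVec ((G - A) *ᵥ u) ((G - A) *ᵥ u) := if_neg hu
  have hquad : ∀ M : Matrix (Fin n) (Fin n) ℝ,
      u ⬝ᵥ (((G - A) * M * (G - A)) *ᵥ u) =
        ((G - A) *ᵥ u) ⬝ᵥ (M *ᵥ ((G - A) *ᵥ u)) := by
    intro M
    rw [← mulVec_mulVec, ← mulVec_mulVec, hsymm.dotProduct_mulVec_comm]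
  have hden : A - A * G⁻¹ * A = (G - A) - (G - A) * G⁻¹ * (G - A) := by
    have h1 : G * G⁻¹ = 1 := mul_nonsing_inv G hdet
    have h2 : A * G⁻¹ * G = A := by rw [mul_assoc, nonsing_inv_mul G hdet, mul_one]
    simp only [sub_mul, mul_sub, h1, h2, one_mul]
    abel
  rw [hden, sub_mulVec, dotProduct_sub, hquad, hquad, hS]
  set v := (G - A) *ᵥ u with hv
  set w := G⁻¹ *ᵥ v with hw
  set s := u ⬝ᵥ v with hs
  have hGw : G *ᵥ w = v := by
    rw [hw, mulVec_mulVec, mul_nonsing_inv G hdet, one_mulVec]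
  have hw0 : w ≠ 0 := fun h => hu (by rw [← hGw, h, mulVec_zero])
  have hq : 0 < v ⬝ᵥ w := by
    rw [dotProduct_comm, ← hGw]
    exact hG.dotProduct_mulVec_self_pos hw0
  have hsq : 0 < s - v ⬝ᵥ w := by
    have h1 := hAG.dotProduct_mulVec_self_nonneg (u - w)
    have h2 := hA.dotProduct_mulVec_self_pos hw0
    have h3 : w ⬝ᵥ ((G - A) *ᵥ w) = v ⬝ᵥ w - w ⬝ᵥ (A *ᵥ w) := by
      rw [sub_mulVec, dotProduct_sub, hGw, dotProduct_comm w v]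
    have h4 : u ⬝ᵥ ((G - A) *ᵥ w) = v ⬝ᵥ w := hsymm.dotProduct_mulVec_comm u w
    rw [mulVec_sub, ← hv, sub_dotProduct, dotProduct_sub, dotProduct_sub, h3, h4,
      dotProduct_comm w v, ← hs] at h1
    linarith
  have hs0 : 0 < s := by linarith
  have hsg : s ≤ u ⬝ᵥ (G *ᵥ u) := by
    have h := hA.dotProduct_mulVec_self_pos hu0
    rw [hs, hv, sub_mulVec, dotProduct_sub]
    linarith
  rw [inv_sub_smul_vecMulVec_mulVec hdet hGw hs0.ne' hsq.ne', dotProduct_smul, smul_eq_mul,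
    div_le_iff₀ (hs0.trans_le hsg), div_mul_eq_mul_div, div_mul_eq_mul_div, mul_comm s]
  gcongr
end

section
/- Consider the quadratic function f(x) = ½xᵀAx − bᵀx on ℝⁿ with A symmetric positive definite and μI ⪯ A ⪯ LI (0 < μ ≤ L), and the SR1 iteration: G₀ = L·I, x₀ ∈ ℝⁿ arbitrary, x_{k+1} = x_k − G_k⁻¹∇f(x_k), u_k = x_{k+1} − x_k, G_{k+1} = SR1(A, G_k, u_k). Then for all k ≥ 0 it holds that A ⪯ G_k ⪯ (L/μ)A and λ_f(x_k) ≤ (1 − μ/L)^k λ_f(x_0), where λ_f(x) = √(∇f(x)ᵀA⁻¹∇f(x)). -/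
open Matrix

/-- For the quadratic f(x) = ½xᵀAx − bᵀx, the gradient norm
λ_f(x) = √(∇f(x)ᵀ A⁻¹ ∇f(x)) with ∇f(x) = Ax − b. -/
noncomputable def lamQ {n : ℕ} (A : Matrix (Fin n) (Fin n) ℝ) (b x : Fin n → ℝ) : ℝ :=
  Real.sqrt ((A *ᵥ x - b) ⬝ᵥ (A⁻¹ *ᵥ (A *ᵥ x - b)))

theorem Matrix.PosSemidef.sq_dotProduct_mulVec_le {n : ℕ} {E : Matrix (Fin n) (Fin n) ℝ}
    (hE : E.PosSemidef) (x y : Fin n → ℝ) :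
    (x ⬝ᵥ (E *ᵥ y)) ^ 2 ≤ (x ⬝ᵥ (E *ᵥ x)) * (y ⬝ᵥ (E *ᵥ y)) := by
  have hsymm : y ⬝ᵥ (E *ᵥ x) = x ⬝ᵥ (E *ᵥ y) := by
    have hT : Eᵀ = E := by simpa using hE.isHermitian.eq
    rw [dotProduct_mulVec, ← mulVec_transpose, hT, dotProduct_comm]
  have hquad : ∀ t : ℝ, 0 ≤ (y ⬝ᵥ (E *ᵥ y)) * (t * t) + (2 * (x ⬝ᵥ (E *ᵥ y))) * t
      + x ⬝ᵥ (E *ᵥ x) := by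
    intro t
    have h := hE.dotProduct_mulVec_nonneg (x + t • y)
    simp only [star_trivial, mulVec_add, mulVec_smul, dotProduct_add, add_dotProduct,
      dotProduct_smul, smul_dotProduct, smul_eq_mul, hsymm] at h
    linarith
  have h := discrim_le_zero hquad
  rw [discrim] at h
  linarith

theorem dotProduct_vecMulVec_self_mulVec {n : ℕ} (w x : Fin n → ℝ) :
    x ⬝ᵥ (vecMulVec w w *ᵥ x) = (x ⬝ᵥ w) ^ 2 := by
  simp [vecMulVec_mulVec, dotProduct_comm w x, sq]

theorem posSemidef_vecMulVec_self {n : ℕ} (w : Fin n → ℝ) : (vecMulVec w w).PosSemidef := by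
  simpa using posSemidef_vecMulVec_self_star w

theorem SR1_sub_posSemidef {n : ℕ} {A G : Matrix (Fin n) (Fin n) ℝ} (hG : (G - A).PosSemidef)
    (u : Fin n → ℝ) : (SR1 A G u - A).PosSemidef := by
  unfold SR1
  split_ifs with hu
  · exact hG
  have hpos : 0 < u ⬝ᵥ ((G - A) *ᵥ u) :=
    lt_of_le_of_ne (by simpa using hG.dotProduct_mulVec_nonneg u)
      fun h => hu ((hG.dotProduct_mulVec_zero_iff u).1 (by simpa using h.symm))
  rw [sub_right_comm]
  have hH := (posSemidef_vecMulVec_self ((G - A) *ᵥ u)).smul (inv_nonneg.2 hpos.le)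
  refine .of_dotProduct_mulVec_nonneg (hG.isHermitian.sub hH.isHermitian) fun x => ?_
  rw [star_trivial, sub_mulVec, dotProduct_sub, smul_mulVec, dotProduct_smul, smul_eq_mul,
    dotProduct_vecMulVec_self_mulVec, sub_nonneg, inv_mul_le_iff₀ hpos, mul_comm]
  exact hG.sq_dotProduct_mulVec_le x u

theorem sub_SR1_posSemidef {n : ℕ} {A G B : Matrix (Fin n) (Fin n) ℝ} (hG : (G - A).PosSemidef)
    (hB : (B - G).PosSemidef) (u : Fin n → ℝ) : (B - SR1 A G u).PosSemidef := by
  unfold SR1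
  split_ifs
  · exact hB
  rw [← sub_add]
  exact hB.add ((posSemidef_vecMulVec_self _).smul
    (inv_nonneg.2 (by simpa using hG.dotProduct_mulVec_nonneg u)))

/-- One quasi-Newton step on a quadratic contracts `lamQ` by `1 - c⁻¹` when `A ⪯ G ⪯ c A`. -/
theorem lamQ_quasiNewton_step_le {n : ℕ} {A G : Matrix (Fin n) (Fin n) ℝ} {c : ℝ} (hc : 1 ≤ c)
    (hA : A.PosDef) (hG : (G - A).PosSemidef) (hB : (c • A - G).PosSemidef)
    (b x : Fin n → ℝ) :
    lamQ A b (x - G⁻¹ *ᵥ (A *ᵥ x - b)) ≤ (1 - c⁻¹) * lamQ A b x := by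
  have hGpd : G.PosDef := by simpa using hA.add_posSemidef hG
  have hGu : IsUnit G.det := (isUnit_iff_isUnit_det _).1 hGpd.isUnit
  have hAu : IsUnit A.det := (isUnit_iff_isUnit_det _).1 hA.isUnit
  set d := G⁻¹ *ᵥ (A *ᵥ x - b) with hd
  set w := A⁻¹ *ᵥ ((G - A) *ᵥ d) with hw
  have hgrad : A *ᵥ x - b = G *ᵥ d := by
    rw [hd, mulVec_mulVec, mul_nonsing_inv _ hGu, one_mulVec]
  have hAw : A *ᵥ w = (G - A) *ᵥ d := by
    rw [hw, mulVec_mulVec, mul_nonsing_inv _ hAu, one_mulVec]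
  have hnext : A *ᵥ (x - d) - b = A *ᵥ w := by
    rw [mulVec_sub, sub_right_comm, hgrad, hAw, sub_mulVec]
  have hgrad' : A *ᵥ x - b = A *ᵥ (d + w) := by
    rw [hgrad, mulVec_add, hAw, sub_mulVec, add_sub_cancel]
  have hinv : ∀ v, A⁻¹ *ᵥ (A *ᵥ v) = v := fun v => by
    rw [mulVec_mulVec, nonsing_inv_mul _ hAu, one_mulVec]
  have hsymm : w ⬝ᵥ (A *ᵥ d) = d ⬝ᵥ (A *ᵥ w) := by
    have hT : Aᵀ = A := by simpa using hA.isHermitian.eq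
    rw [dotProduct_mulVec, ← mulVec_transpose, hT, dotProduct_comm]
  have hs0 : 0 ≤ w ⬝ᵥ (A *ᵥ w) := by simpa using hA.posSemidef.dotProduct_mulVec_nonneg w
  have hq0 : 0 ≤ d ⬝ᵥ (A *ᵥ w) := by
    rw [hAw]; simpa using hG.dotProduct_mulVec_nonneg d
  have hp0 : 0 ≤ d ⬝ᵥ (A *ᵥ d) := by simpa using hA.posSemidef.dotProduct_mulVec_nonneg d
  have hqp := hA.posSemidef.sq_dotProduct_mulVec_le d w
  have hsr := hG.sq_dotProduct_mulVec_le w d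
  rw [← hAw] at hsr
  have hrs : w ⬝ᵥ ((G - A) *ᵥ w) ≤ (c - 1) * (w ⬝ᵥ (A *ᵥ w)) := by
    have h := hB.dotProduct_mulVec_nonneg w
    simp only [star_trivial, sub_mulVec, dotProduct_sub, smul_mulVec, dotProduct_smul,
      smul_eq_mul] at h ⊢
    linarith
  unfold lamQ
  rw [hnext, hgrad', hinv, hinv, dotProduct_comm, dotProduct_comm _ (d + w)]
  simp only [mulVec_add, dotProduct_add, add_dotProduct, hsymm]
  generalize w ⬝ᵥ (A *ᵥ w) = s at *
  generalize d ⬝ᵥ (A *ᵥ w) = q at *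
  generalize d ⬝ᵥ (A *ᵥ d) = p at *
  generalize w ⬝ᵥ ((G - A) *ᵥ w) = r at *
  have hc0 : 0 < c := by linarith
  have ht : 0 ≤ 1 - c⁻¹ := sub_nonneg.2 (inv_le_one_of_one_le₀ hc)
  refine Real.sqrt_le_iff.2 ⟨mul_nonneg ht (Real.sqrt_nonneg _), ?_⟩
  rw [mul_pow, Real.sq_sqrt (by linarith)]
  rcases hs0.eq_or_lt with rfl | hs
  · exact mul_nonneg (sq_nonneg _) (by linarith)
  have hsq : s ≤ (c - 1) * q := by
    have := mul_le_mul_of_nonneg_right hrs hq0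
    nlinarith
  have hsq' : s ≤ (1 - c⁻¹) * (q + s) := by
    rw [show (1 - c⁻¹) * (q + s) = ((c - 1) * (q + s)) / c by field_simp, le_div_iff₀ hc0]
    linarith
  have hsquare := pow_le_pow_left₀ hs.le hsq' 2
  have hmul : (1 - c⁻¹) ^ 2 * (q + s) ^ 2 ≤ (1 - c⁻¹) ^ 2 * (s * (p + q + (q + s))) :=
    mul_le_mul_of_nonneg_left (by nlinarith) (sq_nonneg _)
  rw [mul_pow] at hsquare
  refine le_of_mul_le_mul_left ?_ hs
  nlinarith

/-- Lemma 3.1: linear convergence of the SR1 iteration for the quadratic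
`f(x) = ½xᵀAx − bᵀx`: for all k, `A ⪯ G_k ⪯ (L/μ)A` and
`λ_f(x_k) ≤ (1 − μ/L)^k λ_f(x_0)`. -/
theorem sr1_quadratic_linear_rate {n : ℕ} (A : Matrix (Fin n) (Fin n) ℝ)
    (b : Fin n → ℝ) (μ L : ℝ) (hμ : 0 < μ) (hμL : μ ≤ L) (hA : A.PosDef)
    (hlow : (A - μ • (1 : Matrix (Fin n) (Fin n) ℝ)).PosSemidef)
    (hup : (L • (1 : Matrix (Fin n) (Fin n) ℝ) - A).PosSemidef)
    (x : ℕ → Fin n → ℝ) (G : ℕ → Matrix (Fin n) (Fin n) ℝ)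
    (hG0 : G 0 = L • (1 : Matrix (Fin n) (Fin n) ℝ))
    (hx : ∀ k, x (k+1) = x k - (G k)⁻¹ *ᵥ (A *ᵥ x k - b))
    (hGS : ∀ k, G (k+1) = SR1 A (G k) (x (k+1) - x k)) :
    ∀ k : ℕ, (G k - A).PosSemidef ∧ ((L / μ) • A - G k).PosSemidef ∧
      lamQ A b (x k) ≤ (1 - μ / L) ^ k * lamQ A b (x 0) := by
  have hL : 0 < L := hμ.trans_le hμL
  have hbound : ∀ k, (G k - A).PosSemidef ∧ ((L / μ) • A - G k).PosSemidef := by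
    intro k
    induction k with
    | zero =>
      refine ⟨by rwa [hG0], ?_⟩
      have h : (L / μ) • A - G 0 = (L / μ) • (A - μ • (1 : Matrix (Fin n) (Fin n) ℝ)) := by
        rw [hG0, smul_sub, smul_smul, div_mul_cancel₀ _ hμ.ne']
      rw [h]
      exact hlow.smul (div_pos hL hμ).le
    | succ k ih =>
      rw [hGS]
      exact ⟨SR1_sub_posSemidef ih.1 _, sub_SR1_posSemidef ih.1 ih.2 _⟩
  intro k
  refine ⟨(hbound k).1, (hbound k).2, ?_⟩
  have ht : 0 ≤ 1 - μ / L := sub_nonneg.2 ((div_le_one hL).2 hμL)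
  induction k with
  | zero => simp
  | succ k ih =>
    have hstep := lamQ_quasiNewton_step_le ((one_le_div hμ).2 hμL) hA (hbound k).1 (hbound k).2
      b (x k)
    rw [← hx, inv_div] at hstep
    rw [pow_succ', mul_assoc]
    exact hstep.trans (mul_le_mul_of_nonneg_left ih ht)
end

section
/- Consider the quadratic function f(x) = ½xᵀAx − bᵀx on ℝⁿ with A symmetric positive definite, and the SR1 iteration: G₀ symmetric positive definite with A ⪯ G₀, x₀ ∈ ℝⁿ, x_{k+1} = x_k − G_k⁻¹∇f(x_k), u_k = x_{k+1} − x_k, G_{k+1} = SR1(A, G_k, u_k). If u_iᵀ(G_i − A)u_i > 0 for i = 0, …, k, then the vectors u_0, …, u_k are linearly independent. -/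
open Matrix

theorem SR1_sub_isSymm {n : ℕ} {A G : Matrix (Fin n) (Fin n) ℝ} (h : (G - A).IsSymm)
    (u : Fin n → ℝ) : (SR1 A G u - A).IsSymm := by
  unfold SR1
  split_ifs
  · exact h
  · rw [sub_right_comm]
    exact h.sub (IsSymm.smul (transpose_vecMulVec _ _) _)

theorem SR1_sub_mulVec_of_mulVec_eq_zero {n : ℕ} {A G : Matrix (Fin n) (Fin n) ℝ}
    (h : (G - A).IsSymm) (u : Fin n → ℝ) {w : Fin n → ℝ} (hw : (G - A) *ᵥ w = 0) :
    (SR1 A G u - A) *ᵥ w = 0 := by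
  unfold SR1
  split_ifs
  · exact hw
  · have hd : ((G - A) *ᵥ u) ⬝ᵥ w = 0 := by
      rw [← vecMul_transpose, h.eq, ← dotProduct_mulVec, hw, dotProduct_zero]
    rw [sub_right_comm, sub_mulVec, smul_mulVec, vecMulVec_mulVec, hd, hw]
    simp

theorem SR1_sub_mulVec_self {n : ℕ} {A G : Matrix (Fin n) (Fin n) ℝ} {u : Fin n → ℝ}
    (hu : u ⬝ᵥ ((G - A) *ᵥ u) ≠ 0) : (SR1 A G u - A) *ᵥ u = 0 := by
  have h0 : (G - A) *ᵥ u ≠ 0 := fun h => hu (by rw [h, dotProduct_zero])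
  unfold SR1
  rw [if_neg h0, sub_right_comm, sub_mulVec, smul_mulVec, vecMulVec_mulVec,
    dotProduct_comm ((G - A) *ᵥ u) u, op_smul_eq_smul, smul_smul, inv_mul_cancel₀ hu,
    one_smul, sub_self]

/-- Vectors that are successively annihilated by all later maps, but not by their own, are
linearly independent. -/
theorem linearIndependent_of_mulVec_eq_zero {n : ℕ} {R : ℕ → Matrix (Fin n) (Fin n) ℝ}
    {u : ℕ → Fin n → ℝ} (m : ℕ) (hne : ∀ i < m, R i *ᵥ u i ≠ 0)
    (hzero : ∀ i < m, ∀ j < i, R i *ᵥ u j = 0) :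
    LinearIndependent ℝ (fun i : Fin m => u i) := by
  induction m with
  | zero => exact linearIndependent_empty_type
  | succ m ih =>
    rw [linearIndependent_finSucc']
    refine ⟨ih (fun i hi => hne i (by omega)) (fun i hi => hzero i (by omega)), fun hmem => ?_⟩
    refine hne m (by omega) ?_
    have hle : Submodule.span ℝ (Set.range (Fin.init fun i : Fin (m + 1) => u i)) ≤
        LinearMap.ker (R m).mulVecLin := by
      rw [Submodule.span_le]
      rintro _ ⟨j, rfl⟩
      exact hzero m (by omega) j j.isLt
    exact hle hmem

/-- Lemma 3.3 (first part): if `u_iᵀ(G_i − A)u_i > 0` for i = 0,…,k, then the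
directions `u_0,…,u_k` are linearly independent. -/
theorem sr1_quadratic_directions_independent {n : ℕ}
    (A : Matrix (Fin n) (Fin n) ℝ) (b : Fin n → ℝ) (hA : A.PosDef)
    (x : ℕ → Fin n → ℝ) (G : ℕ → Matrix (Fin n) (Fin n) ℝ)
    (hG0pd : (G 0).PosDef) (hG0 : (G 0 - A).PosSemidef)
    (hx : ∀ j, x (j+1) = x j - (G j)⁻¹ *ᵥ (A *ᵥ x j - b))
    (hGS : ∀ j, G (j+1) = SR1 A (G j) (x (j+1) - x j))
    (k : ℕ)
    (hpos : ∀ i ≤ k, 0 < (x (i+1) - x i) ⬝ᵥ ((G i - A) *ᵥ (x (i+1) - x i))) :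
    LinearIndependent ℝ (fun i : Fin (k+1) => x ((i : ℕ) + 1) - x (i : ℕ)) := by
  have hsymm : ∀ i, (G i - A).IsSymm := by
    intro i
    induction i with
    | zero => exact isHermitian_iff_isSymm.mp hG0.isHermitian
    | succ i ih => rw [hGS]; exact SR1_sub_isSymm ih _
  have hzero : ∀ i < k + 1, ∀ j < i, (G i - A) *ᵥ (x (j + 1) - x j) = 0 := by
    intro i
    induction i with
    | zero => intro _ j hj; omega
    | succ i ih =>
      intro hi j hj
      rw [hGS]
      rcases Nat.lt_succ_iff_lt_or_eq.mp hj with hji | rfl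
      · exact SR1_sub_mulVec_of_mulVec_eq_zero (hsymm i) _ (ih (by omega) j hji)
      · exact SR1_sub_mulVec_self (hpos j (by omega)).ne'
  refine linearIndependent_of_mulVec_eq_zero (R := fun i => G i - A)
    (u := fun i => x (i + 1) - x i) (k + 1) (fun i hi h => ?_) hzero
  exact (hpos i (by omega)).ne' (by rw [h, dotProduct_zero])
end

section
/- Let f : ℝⁿ → ℝ be twice continuously differentiable with Hessian ∇²f satisfying μI ⪯ ∇²f(x) ⪯ LI for all x (0 < μ ≤ L), and M-strongly self-concordant, i.e., ∇²f(y) − ∇²f(x) ⪯ M‖y−x‖_z ∇²f(w) for all x,y,z,w ∈ ℝⁿ, where ‖v‖_z = √(vᵀ∇²f(z)v). Consider the SR1_CS iteration: G₀ = L·I, r_{−1} = 0, and for k ≥ 0: x_{k+1} = x_k − G_k⁻¹∇f(x_k), u_k = x_{k+1} − x_k, r_k = ‖u_k‖_{x_k}, G̃_k = (1 + Mr_{k−1}/2)(1 + Mr_k/2)G_k, J_k = ∫₀¹ ∇²f(x_k + t u_k) dt, G_{k+1} = SR1(J_k, G̃_k, u_k). If for each k it holds that ∇²f(x_k) ⪯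 G_k (in particular this holds at k = 0), then r_k ≤ (1 + Mr_{k−1}/2)·λ_f(x_k) for all k ≥ 0, where λ_f(x) = √(∇f(x)ᵀ[∇²f(x)]⁻¹∇f(x)). -/
open Matrix

/-- The Hessian matrix of `f` at `x`, with entries the second derivatives in the
standard basis directions. -/
noncomputable def hess {n : ℕ} (f : (Fin n → ℝ) → ℝ) (x : Fin n → ℝ) :
    Matrix (Fin n) (Fin n) ℝ :=
  Matrix.of fun i j => iteratedFDeriv ℝ 2 f x ![Pi.single i 1, Pi.single j 1]

/-- The gradient of `f` at `x`. -/
noncomputable def grad {n : ℕ} (f : (Fin n → ℝ) → ℝ) (x : Fin n → ℝ) : Fin n → ℝ :=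
  fun i => fderiv ℝ f x (Pi.single i 1)

/-- The local norm `‖v‖_z = √(vᵀ ∇²f(z) v)`. -/
noncomputable def znorm {n : ℕ} (f : (Fin n → ℝ) → ℝ) (z v : Fin n → ℝ) : ℝ :=
  Real.sqrt (v ⬝ᵥ (hess f z *ᵥ v))

/-- The local gradient norm `λ_f(x) = √(∇f(x)ᵀ [∇²f(x)]⁻¹ ∇f(x))`. -/
noncomputable def lamG {n : ℕ} (f : (Fin n → ℝ) → ℝ) (x : Fin n → ℝ) : ℝ :=
  Real.sqrt (grad f x ⬝ᵥ ((hess f x)⁻¹ *ᵥ grad f x))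

/-- `f` is `M`-strongly self-concordant:
`∇²f(y) − ∇²f(x) ⪯ M‖y−x‖_z ∇²f(w)` for all `x, y, z, w`. -/
def StrongSelfConcordant {n : ℕ} (f : (Fin n → ℝ) → ℝ) (M : ℝ) : Prop :=
  ∀ x y z w : Fin n → ℝ,
    ((M * znorm f z (y - x)) • hess f w - (hess f y - hess f x)).PosSemidef

/-- The averaged Hessian `J_k = ∫₀¹ ∇²f(x_k + t u_k) dt` (entrywise integral),
where `u_k = x_{k+1} − x_k`. -/
noncomputable def Jmat {n : ℕ} (f : (Fin n → ℝ) → ℝ) (x : ℕ → Fin n → ℝ) (k : ℕ) :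
    Matrix (Fin n) (Fin n) ℝ :=
  Matrix.of fun i j => ∫ t in (0:ℝ)..(1:ℝ), hess f (x k + t • (x (k+1) - x k)) i j

/-- If `0 ≺ H ⪯ G`, the quasi-Newton step `-G⁻¹ g` is, in the norm of `H`, no longer than the
Newton step `-H⁻¹ g`. -/
theorem quadForm_neg_inv_mulVec_le {n : ℕ} {H G : Matrix (Fin n) (Fin n) ℝ} (hH : H.PosDef)
    (hGH : (G - H).PosSemidef) (g : Fin n → ℝ) :
    (-(G⁻¹ *ᵥ g)) ⬝ᵥ (H *ᵥ (-(G⁻¹ *ᵥ g))) ≤ g ⬝ᵥ (H⁻¹ *ᵥ g) := by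
  have hG : G.PosDef := by simpa using Matrix.PosDef.posSemidef_add hGH hH
  set u := -(G⁻¹ *ᵥ g) with hu
  set v := H⁻¹ *ᵥ g with hv
  have hGu : G *ᵥ u = -g := by
    rw [hu, mulVec_neg, mulVec_mulVec, mul_nonsing_inv _ hG.det_pos.ne'.isUnit, one_mulVec]
  have hHv : H *ᵥ v = g := by
    rw [hv, mulVec_mulVec, mul_nonsing_inv _ hH.det_pos.ne'.isUnit, one_mulVec]
  have hHT : Hᵀ = H := by simpa using hH.isHermitian.eq
  have hvHu : v ⬝ᵥ (H *ᵥ u) = u ⬝ᵥ g := by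
    rw [dotProduct_mulVec, ← mulVec_transpose, hHT, hHv, dotProduct_comm]
  have hdiff : 0 ≤ u ⬝ᵥ ((G - H) *ᵥ u) := by
    simpa using hGH.dotProduct_mulVec_nonneg u
  have hsum : 0 ≤ (u + v) ⬝ᵥ (H *ᵥ (u + v)) := by
    simpa using hH.posSemidef.dotProduct_mulVec_nonneg (u + v)
  rw [sub_mulVec, dotProduct_sub, hGu, dotProduct_neg] at hdiff
  rw [mulVec_add, hHv, add_dotProduct, dotProduct_add, dotProduct_add, hvHu,
    dotProduct_comm v g] at hsum
  linarith

/-- Lemma 4.3: along the SR1_CS iteration, if `∇²f(x_k) ⪯ G_k` for every k,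
then `r_k ≤ (1 + M r_{k−1}/2) λ_f(x_k)`.  Here `rm k` plays the role of
`r_{k−1}` (with `rm 0 = r_{−1} = 0`). -/
theorem sr1_cs_step_length_bound
    {n : ℕ} (f : (Fin n → ℝ) → ℝ) (μ L M : ℝ)
    (hf : ContDiff ℝ 2 f) (hμ : 0 < μ) (hμL : μ ≤ L) (hM : 0 ≤ M)
    (hlow : ∀ y : Fin n → ℝ, (hess f y - μ • (1 : Matrix (Fin n) (Fin n) ℝ)).PosSemidef)
    (hup : ∀ y : Fin n → ℝ, (L • (1 : Matrix (Fin n) (Fin n) ℝ) - hess f y).PosSemidef)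
    (hssc : StrongSelfConcordant f M)
    (x : ℕ → Fin n → ℝ) (G : ℕ → Matrix (Fin n) (Fin n) ℝ) (r rm : ℕ → ℝ)
    (hG0 : G 0 = L • (1 : Matrix (Fin n) (Fin n) ℝ))
    (hrm0 : rm 0 = 0) (hrmS : ∀ k, rm (k+1) = r k)
    (hx : ∀ k, x (k+1) = x k - (G k)⁻¹ *ᵥ grad f (x k))
    (hr : ∀ k, r k = znorm f (x k) (x (k+1) - x k))
    (hGS : ∀ k, G (k+1) =
      SR1 (Jmat f x k) (((1 + M * rm k / 2) * (1 + M * r k / 2)) • G k) (x (k+1) - x k))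
    (hGH : ∀ k, (G k - hess f (x k)).PosSemidef) :
    ∀ k : ℕ, r k ≤ (1 + M * rm k / 2) * lamG f (x k) := by
  intro k
  have hH : (hess f (x k)).PosDef := by
    simpa using Matrix.PosDef.posSemidef_add (hlow (x k)) (Matrix.PosDef.one.smul hμ)
  have hstep : r k ≤ lamG f (x k) := by
    have hu : x (k + 1) - x k = -((G k)⁻¹ *ᵥ grad f (x k)) := by rw [hx k]; abel
    rw [hr k, hu]
    exact Real.sqrt_le_sqrt (quadForm_neg_inv_mulVec_le hH (hGH k) _)
  have hrm : 0 ≤ rm k := by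
    cases k with
    | zero => exact hrm0.ge
    | succ j => rw [hrmS, hr]; exact Real.sqrt_nonneg _
  have hfactor : 1 ≤ 1 + M * rm k / 2 := le_add_of_nonneg_right (by positivity)
  exact hstep.trans (le_mul_of_one_le_left (Real.sqrt_nonneg _) hfactor)
end

section
/- Let f : ℝⁿ → ℝ be twice continuously differentiable with Hessian ∇²f satisfying μI ⪯ ∇²f(x) ⪯ LI for all x (0 < μ ≤ L, κ = L/μ), and M-strongly self-concordant (∇²f(y) − ∇²f(x) ⪯ M‖y−x‖_z ∇²f(w) for all x,y,z,w, where ‖v‖_z = √(vᵀ∇²f(z)v)). Consider the SR1_CS iteration: G₀ = L·I, r_{−1} = 0, J_{−1} = ∇²f(x₀), and for k ≥ 0: x_{k+1} = x_k − G_k⁻¹∇f(x_k), u_k = x_{k+1} − x_k, r_k = ‖u_k‖_{x_k}, G̃_k = (1 + Mr_{k−1}/2)(1 + Mr_k/2)G_k, J_k = ∫₀¹ ∇²f(x_k + t u_k) dt, G_{k+1} = SR1(J_k, G̃_k, u_k). Suppose M·λ_f(x₀) ≤ ln(3/2)/(4κ), where λ_f(x) = √(∇f(x)ᵀ[∇²f(x)]⁻¹∇f(x)).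 Then for all k ≥ 0: (i) J_{k−1} ⪯ G_k ⪯ ξ_k κ J_{k−1}, where ξ₀ = 1 and ξ_k = e^{M∑_{i=0}^{k−1}(r_{i−1}+r_i)} ≤ 3/2; (ii) e^{Mr_{k−1}/2}·λ_f(x_k) ≤ (1 − 1/(2κ))^k · λ_f(x₀); (iii) r_k ≤ (1 − 1/(2κ))^k · λ_f(x₀). -/
open Matrix

/-- `J_{k−1}` with the convention `J_{−1} = ∇²f(x₀)`. -/
noncomputable def Jprev {n : ℕ} (f : (Fin n → ℝ) → ℝ) (x : ℕ → Fin n → ℝ) (k : ℕ) :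
    Matrix (Fin n) (Fin n) ℝ :=
  if k = 0 then hess f (x 0) else Jmat f x (k - 1)

theorem Matrix.IsHermitian.dotProduct_mulVec_comm {n : ℕ} {A : Matrix (Fin n) (Fin n) ℝ}
    (hA : A.IsHermitian) (a b : Fin n → ℝ) : a ⬝ᵥ A *ᵥ b = b ⬝ᵥ A *ᵥ a := by
  have h : Aᵀ = A := by simpa [IsHermitian, conjTranspose_eq_transpose_of_trivial] using hA
  rw [dotProduct_mulVec, ← mulVec_transpose, h, dotProduct_comm]

theorem posSemidef_sub_iff_forall_le {n : ℕ} {A B : Matrix (Fin n) (Fin n) ℝ}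
    (hA : A.IsHermitian) (hB : B.IsHermitian) :
    (B - A).PosSemidef ↔ ∀ v, v ⬝ᵥ A *ᵥ v ≤ v ⬝ᵥ B *ᵥ v := by
  constructor
  · intro h v
    have := h.dotProduct_mulVec_nonneg v
    simpa [sub_mulVec, dotProduct_sub] using this
  · intro h
    refine PosSemidef.of_dotProduct_mulVec_nonneg (hB.sub hA) fun v => ?_
    simpa [sub_mulVec, dotProduct_sub] using h v

/-- Cauchy–Schwarz for a symmetric form `S` dominated in absolute value by `θ P`. -/
theorem sq_dotProduct_mulVec_le {n : ℕ} {S P : Matrix (Fin n) (Fin n) ℝ} {θ : ℝ}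
    (hS : S.IsHermitian) (hP : P.IsHermitian)
    (h1 : ∀ v, v ⬝ᵥ S *ᵥ v ≤ θ * (v ⬝ᵥ P *ᵥ v))
    (h2 : ∀ v, -(θ * (v ⬝ᵥ P *ᵥ v)) ≤ v ⬝ᵥ S *ᵥ v) (a b : Fin n → ℝ) :
    (a ⬝ᵥ S *ᵥ b) ^ 2 ≤ θ ^ 2 * (a ⬝ᵥ P *ᵥ a) * (b ⬝ᵥ P *ᵥ b) := by
  have key : ∀ t : ℝ, 0 ≤ (θ * (a ⬝ᵥ P *ᵥ a)) * (t * t) + (-(2 * (a ⬝ᵥ S *ᵥ b))) * t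
      + θ * (b ⬝ᵥ P *ᵥ b) := by
    intro t
    have e1 := h1 (t • a + b)
    have e2 := h2 (t • a - b)
    simp only [mulVec_add, mulVec_sub, mulVec_smul, dotProduct_add, dotProduct_sub,
      add_dotProduct, sub_dotProduct, smul_dotProduct, dotProduct_smul, smul_eq_mul] at e1 e2
    rw [hS.dotProduct_mulVec_comm b a, hP.dotProduct_mulVec_comm b a] at e1 e2
    nlinarith
  have := discrim_le_zero key
  unfold discrim at this
  nlinarith

/-- Two-sided bounds satisfied by an SR1 update started above its target. -/
theorem SR1_bounds {n : ℕ} {A G : Matrix (Fin n) (Fin n) ℝ} (hA : A.IsHermitian)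
    (hG : G.IsHermitian) (h : ∀ v, v ⬝ᵥ A *ᵥ v ≤ v ⬝ᵥ G *ᵥ v) (u : Fin n → ℝ) :
    (SR1 A G u).IsHermitian ∧ (∀ v, v ⬝ᵥ A *ᵥ v ≤ v ⬝ᵥ SR1 A G u *ᵥ v) ∧
      ∀ v, v ⬝ᵥ SR1 A G u *ᵥ v ≤ v ⬝ᵥ G *ᵥ v := by
  unfold SR1
  split_ifs with h0
  · exact ⟨hG, h, fun v => le_rfl⟩
  have hR : (G - A).IsHermitian := hG.sub hA
  have hR0 : ∀ v, 0 ≤ v ⬝ᵥ (G - A) *ᵥ v := fun v => by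
    rw [sub_mulVec, dotProduct_sub]; linarith [h v]
  have cs := sq_dotProduct_mulVec_le (θ := 1) hR hR (fun v => by simp)
    (fun v => by linarith [hR0 v])
  have hq : ∀ v, v ⬝ᵥ (G - (u ⬝ᵥ ((G - A) *ᵥ u))⁻¹ •
      vecMulVec ((G - A) *ᵥ u) ((G - A) *ᵥ u)) *ᵥ v =
      v ⬝ᵥ G *ᵥ v - (u ⬝ᵥ ((G - A) *ᵥ u))⁻¹ * (v ⬝ᵥ (G - A) *ᵥ u) ^ 2 := by
    intro v
    rw [sub_mulVec, smul_mulVec, dotProduct_sub, dotProduct_smul, vecMulVec_mulVec]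
    simp only [smul_eq_mul, op_smul_eq_smul, dotProduct_smul]
    rw [dotProduct_comm ((G - A) *ᵥ u) v]
    ring
  refine ⟨?_, fun v => ?_, fun v => ?_⟩
  · refine hG.sub ?_
    ext i j
    simp [vecMulVec_apply, mul_comm]
  · rw [hq]
    have hu := hR0 u
    have hc := cs v u
    have hv := hR0 v
    have hsub : v ⬝ᵥ (G - A) *ᵥ v = v ⬝ᵥ G *ᵥ v - v ⬝ᵥ A *ᵥ v := by
      rw [sub_mulVec, dotProduct_sub]
    have : (u ⬝ᵥ ((G - A) *ᵥ u))⁻¹ * (v ⬝ᵥ (G - A) *ᵥ u) ^ 2 ≤ v ⬝ᵥ (G - A) *ᵥ v := by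
      rcases hu.eq_or_lt with hz | hpos
      · rw [← hz]; simpa using hv
      · rw [inv_mul_le_iff₀ hpos]; linarith
    linarith
  · rw [hq]
    have := mul_nonneg (inv_nonneg.2 (hR0 u)) (sq_nonneg (v ⬝ᵥ (G - A) *ᵥ u))
    linarith

theorem Matrix.IsHermitian.posDef_of_forall {n : ℕ} {A B : Matrix (Fin n) (Fin n) ℝ} {c : ℝ}
    (hB : B.IsHermitian) (hA : A.PosDef) (h : ∀ v, v ⬝ᵥ A *ᵥ v ≤ c * (v ⬝ᵥ B *ᵥ v))
    (hc : 0 ≤ c) : B.PosDef := by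
  refine PosDef.of_dotProduct_mulVec_pos hB fun v hv => ?_
  have := hA.dotProduct_mulVec_pos hv
  simp only [star_trivial] at this ⊢
  exact pos_of_mul_pos_right (this.trans_le (h v)) hc

theorem Matrix.PosDef.mulVec_inv_mulVec {n : ℕ} {A : Matrix (Fin n) (Fin n) ℝ} (hA : A.PosDef)
    (v : Fin n → ℝ) : A *ᵥ (A⁻¹ *ᵥ v) = v := by
  rw [mulVec_mulVec, mul_nonsing_inv _ ((isUnit_iff_isUnit_det _).1 hA.isUnit), one_mulVec]

theorem Matrix.PosDef.inv_mulVec_mulVec {n : ℕ} {A : Matrix (Fin n) (Fin n) ℝ} (hA : A.PosDef)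
    (v : Fin n → ℝ) : A⁻¹ *ᵥ (A *ᵥ v) = v := by
  rw [mulVec_mulVec, nonsing_inv_mul _ ((isUnit_iff_isUnit_det _).1 hA.isUnit), one_mulVec]

theorem Matrix.PosDef.quadForm_nonneg {n : ℕ} {A : Matrix (Fin n) (Fin n) ℝ} (hA : A.PosDef)
    (v : Fin n → ℝ) : 0 ≤ v ⬝ᵥ A *ᵥ v := by
  simpa using hA.posSemidef.dotProduct_mulVec_nonneg v

/-- Matrix inversion reverses the Loewner order. -/
theorem inv_quadForm_le {n : ℕ} {A B : Matrix (Fin n) (Fin n) ℝ} {c : ℝ} (hA : A.PosDef)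
    (hB : B.PosDef) (h : ∀ v, v ⬝ᵥ A *ᵥ v ≤ c * (v ⬝ᵥ B *ᵥ v)) (v : Fin n → ℝ)
    (hc : 0 ≤ c) :
    v ⬝ᵥ B⁻¹ *ᵥ v ≤ c * (v ⬝ᵥ A⁻¹ *ᵥ v) := by
  have cs := sq_dotProduct_mulVec_le (θ := 1) hA.isHermitian hA.isHermitian (fun v => by simp)
    (fun v => by linarith [hA.quadForm_nonneg v]) (B⁻¹ *ᵥ v) (A⁻¹ *ᵥ v)
  have h1 := h (B⁻¹ *ᵥ v)
  rw [hA.mulVec_inv_mulVec] at cs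
  rw [hB.mulVec_inv_mulVec] at h1
  rw [dotProduct_comm (B⁻¹ *ᵥ v) v] at h1 cs
  rw [dotProduct_comm (A⁻¹ *ᵥ v) v] at cs
  have p1 := hA.inv.quadForm_nonneg v
  have p2 := hB.inv.quadForm_nonneg v
  have h2 := mul_le_mul_of_nonneg_right h1 p1
  by_contra! hlt
  nlinarith [mul_nonneg hc p1]

/-- One quasi-Newton step contracts the gradient in the norm of the averaged Hessian. -/
theorem inv_quadForm_residual_le {n : ℕ} {J G : Matrix (Fin n) (Fin n) ℝ} {c η θ : ℝ}
    (hJ : J.PosDef) (hG : G.PosDef) (hJG : ∀ v, v ⬝ᵥ J *ᵥ v ≤ c * (v ⬝ᵥ G *ᵥ v))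
    (hGJ : ∀ v, v ⬝ᵥ G *ᵥ v ≤ η * (v ⬝ᵥ J *ᵥ v)) (hc : 0 ≤ c) (hη : 0 < η)
    (h1 : c - 1 ≤ θ) (h2 : 1 - 1 / η ≤ θ) (g : Fin n → ℝ) :
    (g - J *ᵥ (G⁻¹ *ᵥ g)) ⬝ᵥ J⁻¹ *ᵥ (g - J *ᵥ (G⁻¹ *ᵥ g)) ≤
      θ ^ 2 * (g ⬝ᵥ J⁻¹ *ᵥ g) := by
  set a := g - J *ᵥ (G⁻¹ *ᵥ g) with ha
  have hS : J⁻¹ *ᵥ a = (J⁻¹ - G⁻¹) *ᵥ g := by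
    rw [ha, mulVec_sub, hJ.inv_mulVec_mulVec, sub_mulVec]
  have cs := sq_dotProduct_mulVec_le (θ := θ) (hJ.inv.isHermitian.sub hG.inv.isHermitian)
    hJ.inv.isHermitian (fun v => by
      have e := inv_quadForm_le hG hJ hGJ v hη.le
      have p := hJ.inv.quadForm_nonneg v
      rw [sub_mulVec, dotProduct_sub]
      have e2 : 1 / η * (v ⬝ᵥ J⁻¹ *ᵥ v) ≤ v ⬝ᵥ G⁻¹ *ᵥ v := by
        rw [one_div, inv_mul_le_iff₀ hη]; exact e
      nlinarith) (fun v => by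
      have e := inv_quadForm_le hJ hG hJG v hc
      have p := hJ.inv.quadForm_nonneg v
      rw [sub_mulVec, dotProduct_sub]
      nlinarith) a g
  rw [← hS] at cs
  have p1 := hJ.inv.quadForm_nonneg a
  have p2 := hJ.inv.quadForm_nonneg g
  have p3 := mul_nonneg (sq_nonneg θ) p2
  by_contra! hlt
  nlinarith

/-- The average of the Hessian of `f` over the segment from `a` to `b`. -/
noncomputable def segmentHess {n : ℕ} (f : (Fin n → ℝ) → ℝ) (a b : Fin n → ℝ) :
    Matrix (Fin n) (Fin n) ℝ :=
  Matrix.of fun i j => ∫ t in (0:ℝ)..(1:ℝ), hess f (a + t • (b - a)) i j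

theorem hess_apply_eq {n : ℕ} (f : (Fin n → ℝ) → ℝ) (y : Fin n → ℝ) (i j : Fin n) :
    hess f y i j = fderiv ℝ (fderiv ℝ f) y (Pi.single i 1) (Pi.single j 1) := by
  simp [hess, iteratedFDeriv_two_apply]

theorem continuous_hess_apply {n : ℕ} {f : (Fin n → ℝ) → ℝ} (hf : ContDiff ℝ 2 f)
    (i j : Fin n) : Continuous fun y => hess f y i j := by
  simp only [hess_apply_eq]
  have h1 : ContDiff ℝ 1 (fderiv ℝ f) := hf.fderiv_right (by norm_num)
  have h2 : Continuous (fderiv ℝ (fderiv ℝ f)) := h1.continuous_fderiv (by norm_num)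
  fun_prop

theorem continuous_hess_segment {n : ℕ} {f : (Fin n → ℝ) → ℝ} (hf : ContDiff ℝ 2 f)
    (a u : Fin n → ℝ) (i j : Fin n) : Continuous fun t : ℝ => hess f (a + t • u) i j :=
  (continuous_hess_apply hf i j).comp (by fun_prop)

theorem segmentHess_mulVec_apply {n : ℕ} {f : (Fin n → ℝ) → ℝ} (hf : ContDiff ℝ 2 f)
    (a b v : Fin n → ℝ) (i : Fin n) :
    (segmentHess f a b *ᵥ v) i =
      ∫ t in (0:ℝ)..(1:ℝ), (hess f (a + t • (b - a)) *ᵥ v) i := by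
  simp only [mulVec, dotProduct, segmentHess, of_apply]
  rw [intervalIntegral.integral_finsetSum]
  · simp
  · intro j _
    exact ((continuous_hess_segment hf a (b - a) i j).mul continuous_const).intervalIntegrable _ _

theorem continuous_hess_mulVec_segment {n : ℕ} {f : (Fin n → ℝ) → ℝ} (hf : ContDiff ℝ 2 f)
    (a u v : Fin n → ℝ) (i : Fin n) :
    Continuous fun t : ℝ => (hess f (a + t • u) *ᵥ v) i := by
  simp only [mulVec, dotProduct]
  exact continuous_finsetSum _ fun j _ =>
    (continuous_hess_segment hf a u i j).mul continuous_const

theorem continuous_quadForm_segment {n : ℕ} {f : (Fin n → ℝ) → ℝ} (hf : ContDiff ℝ 2 f)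
    (a u v : Fin n → ℝ) : Continuous fun t : ℝ => v ⬝ᵥ hess f (a + t • u) *ᵥ v := by
  simp only [dotProduct]
  exact continuous_finsetSum _ fun j _ =>
    continuous_const.mul (continuous_hess_mulVec_segment hf a u v j)

theorem quadForm_segmentHess {n : ℕ} {f : (Fin n → ℝ) → ℝ} (hf : ContDiff ℝ 2 f)
    (a b v : Fin n → ℝ) :
    v ⬝ᵥ segmentHess f a b *ᵥ v =
      ∫ t in (0:ℝ)..(1:ℝ), v ⬝ᵥ hess f (a + t • (b - a)) *ᵥ v := by
  simp only [dotProduct, segmentHess_mulVec_apply hf]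
  rw [intervalIntegral.integral_finsetSum]
  · simp
  · intro j _
    exact (continuous_const.mul
      (continuous_hess_mulVec_segment hf a (b - a) v j)).intervalIntegrable _ _

theorem segmentHess_isHermitian {n : ℕ} {f : (Fin n → ℝ) → ℝ}
    (hH : ∀ y, (hess f y).IsHermitian) (a b : Fin n → ℝ) :
    (segmentHess f a b).IsHermitian := by
  ext i j
  simp only [segmentHess, conjTranspose_apply, of_apply, star_trivial]
  congr 1
  ext t
  simpa using (hH (a + t • (b - a))).apply i j

/-- Fundamental theorem of calculus for the gradient along a segment. -/
theorem grad_sub_grad {n : ℕ} {f : (Fin n → ℝ) → ℝ} (hf : ContDiff ℝ 2 f)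
    (hH : ∀ y, (hess f y).IsHermitian) (a b : Fin n → ℝ) :
    grad f b = grad f a + segmentHess f a b *ᵥ (b - a) := by
  ext i
  have h1 : ContDiff ℝ 1 (fderiv ℝ f) := hf.fderiv_right (by norm_num)
  have hd : ∀ t ∈ Set.uIcc (0:ℝ) 1, HasDerivAt (fun t : ℝ => grad f (a + t • (b - a)) i)
      ((hess f (a + t • (b - a)) *ᵥ (b - a)) i) t := by
    intro t _
    have e1 : HasDerivAt (fun t : ℝ => a + t • (b - a)) (b - a) t := by
      simpa using ((hasDerivAt_id t).smul_const (b - a)).const_add a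
    have e2 : HasFDerivAt (fderiv ℝ f) (fderiv ℝ (fderiv ℝ f) (a + t • (b - a)))
        (a + t • (b - a)) :=
      (h1.differentiable (by norm_num) (a + t • (b - a))).hasFDerivAt
    have e3 : HasDerivAt (fun t : ℝ => fderiv ℝ f (a + t • (b - a)))
        (fderiv ℝ (fderiv ℝ f) (a + t • (b - a)) (b - a)) t := e2.comp_hasDerivAt t e1
    have e4 : HasDerivAt (fun t : ℝ => grad f (a + t • (b - a)) i)
        (fderiv ℝ (fderiv ℝ f) (a + t • (b - a)) (b - a) (Pi.single i 1)) t :=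
      (ContinuousLinearMap.apply ℝ ℝ
        (Pi.single i 1 : Fin n → ℝ)).hasFDerivAt.comp_hasDerivAt t e3
    refine e4.congr_deriv ?_
    generalize a + t • (b - a) = z
    generalize b - a = u
    conv_lhs => rw [← Finset.univ_sum_single u]
    simp only [mulVec, dotProduct, map_sum, _root_.sum_apply]
    refine Finset.sum_congr rfl fun j _ => ?_
    have : (Pi.single j (u j) : Fin n → ℝ) = u j • Pi.single j 1 := by
      rw [← Pi.single_smul]; simp
    rw [this, map_smul, _root_.smul_apply, ← hess_apply_eq, smul_eq_mul, mul_comm]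
    congr 1
    simpa using (hH z).apply i j
  have := intervalIntegral.integral_eq_sub_of_hasDerivAt hd
    ((continuous_hess_mulVec_segment hf a (b - a) (b - a) i).intervalIntegrable _ _)
  rw [← segmentHess_mulVec_apply hf] at this
  simp only [zero_smul, add_zero, one_smul, add_sub_cancel] at this
  simp only [Pi.add_apply]
  linarith

theorem znorm_smul {n : ℕ} (f : (Fin n → ℝ) → ℝ) (z v : Fin n → ℝ) {t : ℝ} (ht : 0 ≤ t) :
    znorm f z (t • v) = t * znorm f z v := by
  unfold znorm
  rw [mulVec_smul, dotProduct_smul, smul_dotProduct, smul_eq_mul, smul_eq_mul, ← mul_assoc,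
    Real.sqrt_mul (mul_nonneg ht ht), Real.sqrt_mul_self ht]

theorem integral_le_of_le_affine {φ : ℝ → ℝ} (hφ : Continuous φ) {p m : ℝ}
    (h : ∀ t ∈ Set.Icc (0:ℝ) 1, φ t ≤ p + m * t) :
    ∫ t in (0:ℝ)..1, φ t ≤ p + m / 2 := by
  calc ∫ t in (0:ℝ)..1, φ t ≤ ∫ t in (0:ℝ)..1, (p + m * t) :=
        intervalIntegral.integral_mono_on zero_le_one (hφ.intervalIntegrable _ _)
          ((by fun_prop : Continuous fun t : ℝ => p + m * t).intervalIntegrable _ _) h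
    _ = p + m / 2 := by
        rw [intervalIntegral.integral_add (by simp)
          ((by fun_prop : Continuous fun t : ℝ => m * t).intervalIntegrable _ _),
          intervalIntegral.integral_const_mul, integral_id]
        simp
        ring

theorem le_integral_of_affine_le {φ : ℝ → ℝ} (hφ : Continuous φ) {p m : ℝ}
    (h : ∀ t ∈ Set.Icc (0:ℝ) 1, p + m * t ≤ φ t) :
    p + m / 2 ≤ ∫ t in (0:ℝ)..1, φ t := by
  have := integral_le_of_le_affine (φ := fun t => -φ t) hφ.neg (p := -p) (m := -m)
    (fun t ht => by linarith [h t ht])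
  rw [intervalIntegral.integral_neg] at this
  linarith

theorem StrongSelfConcordant.quadForm_sub_le {n : ℕ} {f : (Fin n → ℝ) → ℝ} {M : ℝ}
    (hssc : StrongSelfConcordant f M) (x y z w v : Fin n → ℝ) :
    v ⬝ᵥ hess f y *ᵥ v - v ⬝ᵥ hess f x *ᵥ v ≤
      M * znorm f z (y - x) * (v ⬝ᵥ hess f w *ᵥ v) := by
  have := (hssc x y z w).dotProduct_mulVec_nonneg v
  simp only [star_trivial, sub_mulVec, smul_mulVec, dotProduct_sub, dotProduct_smul,
    smul_eq_mul] at this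
  linarith

theorem znorm_neg {n : ℕ} (f : (Fin n → ℝ) → ℝ) (z v : Fin n → ℝ) :
    znorm f z (-v) = znorm f z v := by
  simp [znorm, mulVec_neg]

/-- Hessians along a segment of a strongly self-concordant function. -/
theorem StrongSelfConcordant.segment {n : ℕ} {f : (Fin n → ℝ) → ℝ} {M : ℝ}
    (hssc : StrongSelfConcordant f M) (a u w v : Fin n → ℝ) (s t : ℝ) :
    v ⬝ᵥ hess f (a + s • u) *ᵥ v - v ⬝ᵥ hess f (a + t • u) *ᵥ v ≤
      M * (|s - t| * znorm f a u) * (v ⬝ᵥ hess f w *ᵥ v) := by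
  have h := hssc.quadForm_sub_le (a + t • u) (a + s • u) a w v
  have e : a + s • u - (a + t • u) = (s - t) • u := by module
  rw [e] at h
  rcases le_total 0 (s - t) with h0 | h0
  · rwa [abs_of_nonneg h0, ← znorm_smul f a u h0]
  · rwa [abs_of_nonpos h0, ← znorm_smul f a u (neg_nonneg.2 h0), neg_smul, znorm_neg]

theorem StrongSelfConcordant.segmentHess_bounds {n : ℕ} {f : (Fin n → ℝ) → ℝ} {M : ℝ}
    (hssc : StrongSelfConcordant f M) (hf : ContDiff ℝ 2 f) (a b v : Fin n → ℝ) :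
    v ⬝ᵥ segmentHess f a b *ᵥ v ≤ (1 + M * znorm f a (b - a) / 2) * (v ⬝ᵥ hess f a *ᵥ v) ∧
    v ⬝ᵥ hess f a *ᵥ v ≤ (1 + M * znorm f a (b - a) / 2) * (v ⬝ᵥ segmentHess f a b *ᵥ v) ∧
    v ⬝ᵥ segmentHess f a b *ᵥ v ≤ (1 + M * znorm f a (b - a) / 2) * (v ⬝ᵥ hess f b *ᵥ v) ∧
    v ⬝ᵥ hess f b *ᵥ v ≤
      (1 + M * znorm f a (b - a) / 2) * (v ⬝ᵥ segmentHess f a b *ᵥ v) := by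
  set ρ := znorm f a (b - a)
  set φ : ℝ → ℝ := fun t => v ⬝ᵥ hess f (a + t • (b - a)) *ᵥ v with hφ
  have hcont : Continuous φ := continuous_quadForm_segment hf a (b - a) v
  have h0 : v ⬝ᵥ hess f a *ᵥ v = φ 0 := by simp [hφ]
  have h1 : v ⬝ᵥ hess f b *ᵥ v = φ 1 := by simp [hφ]
  have key : ∀ s t w : ℝ, φ s - φ t ≤ M * (|s - t| * ρ) * φ w :=
    fun s t w => hssc.segment a (b - a) _ v s t
  have keyI : ∀ s t : ℝ, φ s - φ t ≤ M * (|s - t| * ρ) * ∫ w in (0:ℝ)..1, φ w := by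
    intro s t
    have := le_integral_of_affine_le (φ := fun w => M * (|s - t| * ρ) * φ w) (by fun_prop)
      (p := φ s - φ t) (m := 0) (fun w _ => by simpa using key s t w)
    rw [intervalIntegral.integral_const_mul] at this
    simpa using this
  rw [quadForm_segmentHess hf, h0, h1]
  set I := ∫ w in (0:ℝ)..1, φ w
  refine ⟨?_, ?_, ?_, ?_⟩
  · have := integral_le_of_le_affine hcont (p := φ 0) (m := M * ρ * φ 0) (fun t ht => by
      have := key t 0 0
      rw [sub_zero, abs_of_nonneg ht.1] at this
      linarith)
    linarith
  · have := le_integral_of_affine_le hcont (p := φ 0) (m := -(M * ρ * I)) (fun t ht => by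
      have := keyI 0 t
      rw [abs_sub_comm, sub_zero, abs_of_nonneg ht.1] at this
      linarith)
    linarith
  · have := integral_le_of_le_affine hcont (p := φ 1 + M * ρ * φ 1) (m := -(M * ρ * φ 1))
      (fun t ht => by
        have := key t 1 1
        rw [abs_sub_comm, abs_of_nonneg (sub_nonneg.2 ht.2)] at this
        linarith)
    linarith
  · have := le_integral_of_affine_le hcont (p := φ 1 - M * ρ * I) (m := M * ρ * I)
      (fun t ht => by
        have := keyI 1 t
        rw [abs_of_nonneg (sub_nonneg.2 ht.2)] at this
        linarith)
    linarith

/-- The scalar inequality behind the linear contraction factor `1 - 1 / (2κ)`. -/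
theorem exp_mul_contraction_le {κ ξ a b : ℝ} (hκ : 1 ≤ κ) (hξ : 1 ≤ ξ) (ha : 0 ≤ a)
    (hb : 0 ≤ b) (hκa : κ * a ≤ 1 / 8) (hexp : ξ * Real.exp (b + a) ≤ 3 / 2) :
    (1 + b / 2) * (1 + a / 2) - 1 ≤ (1 - 1 / (2 * κ)) * Real.exp (-a) ∧
    1 - 1 / (ξ * κ * ((1 + b / 2) * (1 + a / 2))) ≤ (1 - 1 / (2 * κ)) * Real.exp (-a) := by
  have ha8 : a ≤ 1 / 8 := by nlinarith
  have hE : 1 - a ≤ Real.exp (-a) := by linarith [Real.add_one_le_exp (-a)]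
  have hρ : 1 / 2 ≤ 1 - 1 / (2 * κ) := by
    have : 1 / (2 * κ) ≤ 1 / 2 := by gcongr; linarith
    linarith
  have hba : 1 + (b + a) ≤ Real.exp (b + a) := by linarith [Real.add_one_le_exp (b + a)]
  have hba2 : b + a ≤ 1 / 2 := by nlinarith
  have hmul : (1 - 1 / (2 * κ)) * (1 - a) ≤ (1 - 1 / (2 * κ)) * Real.exp (-a) :=
    mul_le_mul_of_nonneg_left hE (by linarith)
  refine ⟨by nlinarith [mul_nonneg ha hb, sq_nonneg (a - b)], le_trans ?_ hmul⟩
  have hc : (1 + b / 2) * (1 + a / 2) ≤ Real.exp (b + a) := by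
    refine le_trans ?_ hba
    nlinarith [mul_nonneg ha hb]
  have hc0 : 0 < (1 + b / 2) * (1 + a / 2) := by positivity
  have hη : ξ * κ * ((1 + b / 2) * (1 + a / 2)) ≤ 3 / 2 * κ := by
    have := mul_le_mul_of_nonneg_left hc (by linarith : 0 ≤ ξ)
    nlinarith
  have h3 : 1 / (3 / 2 * κ) ≤ 1 / (ξ * κ * ((1 + b / 2) * (1 + a / 2))) := by
    apply one_div_le_one_div_of_le _ hη
    positivity
  have h4 : 1 - 1 / (3 / 2 * κ) ≤ (1 - 1 / (2 * κ)) * (1 - a) := by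
    have hk : 0 < κ := by linarith
    have : (1 - 1 / (2 * κ)) * (1 - a) - (1 - 1 / (3 / 2 * κ)) =
      (1 / 6 - κ * a + a / 2) / κ := by field_simp; ring
    have h5 : 0 ≤ (1 / 6 - κ * a + a / 2) / κ := by
      apply div_nonneg _ hk.le
      linarith
    linarith
  linarith

theorem sqrt_quadForm_step_le {n : ℕ} {H G : Matrix (Fin n) (Fin n) ℝ} {e : ℝ}
    (hH : H.PosDef) (hG : G.PosDef) (he : 0 ≤ e)
    (h : ∀ v, v ⬝ᵥ H *ᵥ v ≤ e * (v ⬝ᵥ G *ᵥ v)) (g : Fin n → ℝ) :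
    √(-(G⁻¹ *ᵥ g) ⬝ᵥ H *ᵥ (-(G⁻¹ *ᵥ g))) ≤ e * √(g ⬝ᵥ H⁻¹ *ᵥ g) := by
  have h1 := h (-(G⁻¹ *ᵥ g))
  have h2 := inv_quadForm_le hH hG h g he
  have h3 : -(G⁻¹ *ᵥ g) ⬝ᵥ G *ᵥ (-(G⁻¹ *ᵥ g)) = g ⬝ᵥ G⁻¹ *ᵥ g := by
    rw [mulVec_neg, neg_dotProduct, dotProduct_neg, neg_neg, hG.mulVec_inv_mulVec,
      dotProduct_comm]
  rw [h3] at h1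
  calc √(-(G⁻¹ *ᵥ g) ⬝ᵥ H *ᵥ (-(G⁻¹ *ᵥ g))) ≤ √(e ^ 2 * (g ⬝ᵥ H⁻¹ *ᵥ g)) :=
        Real.sqrt_le_sqrt (by nlinarith)
    _ = e * √(g ⬝ᵥ H⁻¹ *ᵥ g) := by
        rw [Real.sqrt_mul (sq_nonneg e), Real.sqrt_sq he]

theorem sqrt_inv_quadForm_residual_le {n : ℕ} {H H' J G : Matrix (Fin n) (Fin n) ℝ}
    {c η θ d : ℝ} (hH : H.PosDef) (hH' : H'.PosDef) (hJ : J.PosDef) (hG : G.PosDef)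
    (hJG : ∀ v, v ⬝ᵥ J *ᵥ v ≤ c * (v ⬝ᵥ G *ᵥ v))
    (hGJ : ∀ v, v ⬝ᵥ G *ᵥ v ≤ η * (v ⬝ᵥ J *ᵥ v)) (hc : 0 ≤ c) (hη : 0 < η)
    (h1 : c - 1 ≤ θ) (h2 : 1 - 1 / η ≤ θ) (hθ : 0 ≤ θ) (hd : 0 ≤ d)
    (hHJ : ∀ v, v ⬝ᵥ H *ᵥ v ≤ d * (v ⬝ᵥ J *ᵥ v))
    (hJH : ∀ v, v ⬝ᵥ J *ᵥ v ≤ d * (v ⬝ᵥ H' *ᵥ v)) (g : Fin n → ℝ) :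
    √((g - J *ᵥ (G⁻¹ *ᵥ g)) ⬝ᵥ H'⁻¹ *ᵥ (g - J *ᵥ (G⁻¹ *ᵥ g))) ≤
      d * θ * √(g ⬝ᵥ H⁻¹ *ᵥ g) := by
  have e1 := inv_quadForm_le hJ hH' hJH (g - J *ᵥ (G⁻¹ *ᵥ g)) hd
  have e2 := inv_quadForm_residual_le hJ hG hJG hGJ hc hη h1 h2 g
  have e3 := inv_quadForm_le hH hJ hHJ g hd
  have e4 := mul_le_mul_of_nonneg_left e2 hd
  have e5 := mul_le_mul_of_nonneg_left e3 (mul_nonneg hd (sq_nonneg θ))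
  calc √((g - J *ᵥ (G⁻¹ *ᵥ g)) ⬝ᵥ H'⁻¹ *ᵥ (g - J *ᵥ (G⁻¹ *ᵥ g)))
      ≤ √((d * θ) ^ 2 * (g ⬝ᵥ H⁻¹ *ᵥ g)) := Real.sqrt_le_sqrt (by linarith)
    _ = d * θ * √(g ⬝ᵥ H⁻¹ *ᵥ g) := by
        rw [Real.sqrt_mul (sq_nonneg _), Real.sqrt_sq (mul_nonneg hd hθ)]

theorem sum_pow_one_sub_le {κ : ℝ} (hκ : 1 ≤ κ) (k : ℕ) :
    ∑ i ∈ Finset.range k, (1 - 1 / (2 * κ)) ^ i ≤ 2 * κ := by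
  have hκ0 : κ ≠ 0 := by positivity
  have h : ∑ i ∈ Finset.range k, (1 - 1 / (2 * κ)) ^ i =
      2 * κ * (1 - (1 - 1 / (2 * κ)) ^ k) := by
    induction k with
    | zero => simp
    | succ k ih =>
      rw [Finset.sum_range_succ, ih, pow_succ]
      generalize (1 - 1 / (2 * κ)) ^ k = p
      field_simp
      ring
  have h0 : 0 ≤ 1 - 1 / (2 * κ) := by
    rw [sub_nonneg, div_le_one (by positivity)]
    linarith
  have := pow_nonneg h0 k
  rw [h]
  nlinarith

theorem exp_sum_le_of_geometric {κ M l : ℝ} {r rm : ℕ → ℝ} (hκ : 1 ≤ κ) (hM : 0 ≤ M)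
    (hl : 0 ≤ l) (hrm0 : rm 0 = 0) (hrmS : ∀ k, rm (k + 1) = r k) (hr : ∀ k, 0 ≤ r k)
    (hloc : M * l ≤ Real.log (3 / 2) / (4 * κ)) (k : ℕ)
    (h : ∀ i < k, r i ≤ (1 - 1 / (2 * κ)) ^ i * l) :
    Real.exp (M * ∑ i ∈ Finset.range k, (rm i + r i)) ≤ 3 / 2 := by
  have h1 : ∑ i ∈ Finset.range k, rm i + rm k = ∑ i ∈ Finset.range k, r i := by
    clear h
    induction k with
    | zero => simp [hrm0]
    | succ k ih => rw [Finset.sum_range_succ, Finset.sum_range_succ, ih, hrmS]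
  have h2 : 0 ≤ rm k := by
    cases k with
    | zero => exact hrm0.ge
    | succ k => rw [hrmS]; exact hr k
  have h3 : ∑ i ∈ Finset.range k, r i ≤ 2 * κ * l := by
    calc ∑ i ∈ Finset.range k, r i
        ≤ ∑ i ∈ Finset.range k, (1 - 1 / (2 * κ)) ^ i * l :=
          Finset.sum_le_sum fun i hi => h i (Finset.mem_range.1 hi)
      _ = (∑ i ∈ Finset.range k, (1 - 1 / (2 * κ)) ^ i) * l := by rw [Finset.sum_mul]
      _ ≤ 2 * κ * l := mul_le_mul_of_nonneg_right (sum_pow_one_sub_le hκ k) hl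
  have h4 : M * ∑ i ∈ Finset.range k, (rm i + r i) ≤ Real.log (3 / 2) := by
    rw [le_div_iff₀ (by positivity)] at hloc
    rw [Finset.sum_add_distrib]
    have : ∑ i ∈ Finset.range k, rm i + ∑ i ∈ Finset.range k, r i ≤ 4 * κ * l := by linarith
    have := mul_le_mul_of_nonneg_left this hM
    linarith
  calc Real.exp (M * ∑ i ∈ Finset.range k, (rm i + r i)) ≤ Real.exp (Real.log (3 / 2)) :=
        Real.exp_le_exp.2 h4
    _ = 3 / 2 := Real.exp_log (by norm_num)

/-- Theorem 4.1: along the SR1_CS iteration started with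
`Mλ_f(x₀) ≤ ln(3/2)/(4κ)`, one has for all k:
`J_{k−1} ⪯ G_k ⪯ ξ_k κ J_{k−1}` with `ξ_k = e^{M∑_{i<k}(r_{i−1}+r_i)} ≤ 3/2`,
`e^{M r_{k−1}/2} λ_f(x_k) ≤ (1 − 1/(2κ))^k λ_f(x₀)`, and
`r_k ≤ (1 − 1/(2κ))^k λ_f(x₀)`.  Here `rm k` denotes `r_{k−1}` (`rm 0 = 0`). -/
theorem sr1_cs_base
    {n : ℕ} (f : (Fin n → ℝ) → ℝ) (μ L M : ℝ)
    (hf : ContDiff ℝ 2 f) (hμ : 0 < μ) (hμL : μ ≤ L) (hM : 0 ≤ M)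
    (hlow : ∀ y : Fin n → ℝ, (hess f y - μ • (1 : Matrix (Fin n) (Fin n) ℝ)).PosSemidef)
    (hup : ∀ y : Fin n → ℝ, (L • (1 : Matrix (Fin n) (Fin n) ℝ) - hess f y).PosSemidef)
    (hssc : StrongSelfConcordant f M)
    (x : ℕ → Fin n → ℝ) (G : ℕ → Matrix (Fin n) (Fin n) ℝ) (r rm : ℕ → ℝ)
    (hG0 : G 0 = L • (1 : Matrix (Fin n) (Fin n) ℝ))
    (hrm0 : rm 0 = 0) (hrmS : ∀ k, rm (k+1) = r k)
    (hx : ∀ k, x (k+1) = x k - (G k)⁻¹ *ᵥ grad f (x k))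
    (hr : ∀ k, r k = znorm f (x k) (x (k+1) - x k))
    (hGS : ∀ k, G (k+1) =
      SR1 (Jmat f x k) (((1 + M * rm k / 2) * (1 + M * r k / 2)) • G k) (x (k+1) - x k))
    (hloc : M * lamG f (x 0) ≤ Real.log (3 / 2) / (4 * (L / μ))) :
    ∀ k : ℕ,
      (G k - Jprev f x k).PosSemidef ∧
      (((Real.exp (M * ∑ i ∈ Finset.range k, (rm i + r i)) * (L / μ)) •
          Jprev f x k) - G k).PosSemidef ∧
      Real.exp (M * ∑ i ∈ Finset.range k, (rm i + r i)) ≤ 3 / 2 ∧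
      Real.exp (M * rm k / 2) * lamG f (x k) ≤
        (1 - 1 / (2 * (L / μ))) ^ k * lamG f (x 0) ∧
      r k ≤ (1 - 1 / (2 * (L / μ))) ^ k * lamG f (x 0) := by
  set κ := L / μ with hκdef
  have hκ : 1 ≤ κ := (one_le_div hμ).2 hμL
  have hHs : ∀ y, (hess f y).IsHermitian := fun y => by
    simpa using (hlow y).isHermitian.add
      ((isHermitian_one (n := Fin n) (α := ℝ)).smul (IsSelfAdjoint.all μ))
  have hIs : ∀ c : ℝ, (c • (1 : Matrix (Fin n) (Fin n) ℝ)).IsHermitian := fun c =>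
    isHermitian_one.smul (IsSelfAdjoint.all c)
  have hlow' := fun y => (posSemidef_sub_iff_forall_le (hIs μ) (hHs y)).1 (hlow y)
  have hup' := fun y => (posSemidef_sub_iff_forall_le (hHs y) (hIs L)).1 (hup y)
  have hHpd : ∀ y, (hess f y).PosDef := fun y =>
    (hHs y).posDef_of_forall (PosDef.one.smul hμ) (c := 1) (by simpa using hlow' y) zero_le_one
  have hr0 : ∀ k, 0 ≤ r k := fun k => by rw [hr]; exact Real.sqrt_nonneg _
  have hrm0' : ∀ k, 0 ≤ rm k := fun k => by
    cases k with
    | zero => exact hrm0.ge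
    | succ k => rw [hrmS]; exact hr0 k
  have hl0 : ∀ y, 0 ≤ lamG f y := fun y => Real.sqrt_nonneg _
  have hJs : ∀ k, (Jmat f x k).IsHermitian := fun k => segmentHess_isHermitian hHs _ _
  have hJb := fun k v => hssc.segmentHess_bounds hf (x k) (x (k + 1)) v
  simp only [← hr] at hJb
  change ∀ k v, v ⬝ᵥ Jmat f x k *ᵥ v ≤ _ ∧ _ ≤ _ * (v ⬝ᵥ Jmat f x k *ᵥ v) ∧
    v ⬝ᵥ Jmat f x k *ᵥ v ≤ _ ∧ _ ≤ _ * (v ⬝ᵥ Jmat f x k *ᵥ v) at hJb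
  have hd : ∀ k, 0 ≤ 1 + M * r k / 2 := fun k => by have := hr0 k; positivity
  have hdm : ∀ k, 0 ≤ 1 + M * rm k / 2 := fun k => by have := hrm0' k; positivity
  have hJpd : ∀ k, (Jmat f x k).PosDef := fun k =>
    (hJs k).posDef_of_forall (hHpd (x k)) (fun v => (hJb k v).2.1) (hd k)
  have hPs : ∀ k, (Jprev f x k).IsHermitian := fun k => by
    unfold Jprev
    split_ifs
    exacts [hHs _, hJs _]
  have hPb : ∀ k v, v ⬝ᵥ Jprev f x k *ᵥ v ≤ (1 + M * rm k / 2) * (v ⬝ᵥ hess f (x k) *ᵥ v) ∧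
      v ⬝ᵥ hess f (x k) *ᵥ v ≤ (1 + M * rm k / 2) * (v ⬝ᵥ Jprev f x k *ᵥ v) := by
    intro k v
    cases k with
    | zero => simp [Jprev, hrm0]
    | succ k =>
      rw [hrmS]
      simpa [Jprev] using (hJb k v).2.2
  set ρ := 1 - 1 / (2 * κ) with hρ
  have hρ0 : 0 ≤ ρ := by
    rw [hρ, sub_nonneg, div_le_one (by positivity)]
    linarith
  set ξ : ℕ → ℝ := fun k => Real.exp (M * ∑ i ∈ Finset.range k, (rm i + r i)) with hξ
  have hξ1 : ∀ k, 1 ≤ ξ k := fun k => Real.one_le_exp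
    (mul_nonneg hM (Finset.sum_nonneg fun i _ => add_nonneg (hrm0' i) (hr0 i)))
  have hξS : ∀ k, ξ (k + 1) = ξ k * Real.exp (M * rm k + M * r k) := fun k => by
    simp only [hξ]
    rw [Finset.sum_range_succ, ← Real.exp_add]
    ring_nf
  have hξle := exp_sum_le_of_geometric hκ hM (hl0 (x 0)) hrm0 hrmS hr0 hloc
  have hrstep : ∀ k, (G k).PosDef → (∀ v, v ⬝ᵥ Jprev f x k *ᵥ v ≤ v ⬝ᵥ G k *ᵥ v) →
      r k ≤ (1 + M * rm k / 2) * lamG f (x k) := fun k hG hGl => by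
    have hu : x (k + 1) - x k = -((G k)⁻¹ *ᵥ grad f (x k)) := by rw [hx]; abel
    rw [hr, hu]
    exact sqrt_quadForm_step_le (hHpd _) hG (hdm k) (fun v =>
      (hPb k v).2.trans (mul_le_mul_of_nonneg_left (hGl v) (hdm k))) _
  have hGpd : ∀ k, (G k).IsHermitian → (∀ v, v ⬝ᵥ Jprev f x k *ᵥ v ≤ v ⬝ᵥ G k *ᵥ v) →
      (G k).PosDef := fun k hs hGl =>
    hs.posDef_of_forall (hHpd (x k)) (fun v =>
      (hPb k v).2.trans (mul_le_mul_of_nonneg_left (hGl v) (hdm k))) (hdm k)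
  have main : ∀ k, (G k).IsHermitian ∧ (∀ v, v ⬝ᵥ Jprev f x k *ᵥ v ≤ v ⬝ᵥ G k *ᵥ v) ∧
      (∀ v, v ⬝ᵥ G k *ᵥ v ≤ ξ k * κ * (v ⬝ᵥ Jprev f x k *ᵥ v)) ∧
      Real.exp (M * rm k / 2) * lamG f (x k) ≤ ρ ^ k * lamG f (x 0) ∧
      ∀ i < k + 1, r i ≤ ρ ^ i * lamG f (x 0) := by
    have hrk : ∀ k, (G k).PosDef → (∀ v, v ⬝ᵥ Jprev f x k *ᵥ v ≤ v ⬝ᵥ G k *ᵥ v) →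
        Real.exp (M * rm k / 2) * lamG f (x k) ≤ ρ ^ k * lamG f (x 0) →
        r k ≤ ρ ^ k * lamG f (x 0) := fun k hG hGl hl => by
      refine (hrstep k hG hGl).trans (le_trans ?_ hl)
      exact mul_le_mul_of_nonneg_right (by linarith [Real.add_one_le_exp (M * rm k / 2)])
        (hl0 _)
    intro k
    induction k with
    | zero =>
      have g1 : (G 0).IsHermitian := hG0 ▸ hIs L
      have g2 : ∀ v, v ⬝ᵥ Jprev f x 0 *ᵥ v ≤ v ⬝ᵥ G 0 *ᵥ v := by
        simpa [Jprev, hG0] using hup' (x 0)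
      have g4 : Real.exp (M * rm 0 / 2) * lamG f (x 0) ≤ ρ ^ 0 * lamG f (x 0) := by
        simp [hrm0]
      refine ⟨g1, g2, fun v => ?_, g4, fun i hi => ?_⟩
      · have := hlow' (x 0) v
        simp only [smul_mulVec, one_mulVec, dotProduct_smul, smul_eq_mul] at this
        simp only [hξ, Jprev, hG0, Finset.range_zero, Finset.sum_empty, mul_zero, Real.exp_zero,
          one_mul, if_true, smul_mulVec, one_mulVec, dotProduct_smul, smul_eq_mul]
        calc L * (v ⬝ᵥ v) = κ * (μ * (v ⬝ᵥ v)) := by rw [hκdef]; field_simp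
          _ ≤ κ * (v ⬝ᵥ hess f (x 0) *ᵥ v) := by gcongr
      · obtain rfl : i = 0 := by omega
        exact hrk 0 (hGpd 0 g1 g2) g2 g4
    | succ k ih =>
      obtain ⟨i1, i2, i3, i4, i5⟩ := ih
      have hGk := hGpd k i1 i2
      set a := M * r k with ha
      set b := M * rm k with hb
      have ha0 : 0 ≤ a := mul_nonneg hM (hr0 k)
      have hb0 : 0 ≤ b := mul_nonneg hM (hrm0' k)
      set c := (1 + b / 2) * (1 + a / 2) with hc
      have hc0 : 0 < c := by positivity
      have hPJ : ∀ v, v ⬝ᵥ Jmat f x k *ᵥ v ≤ c * (v ⬝ᵥ Jprev f x k *ᵥ v) ∧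
          v ⬝ᵥ Jprev f x k *ᵥ v ≤ c * (v ⬝ᵥ Jmat f x k *ᵥ v) := fun v => by
        have e1 := mul_le_mul_of_nonneg_left (hPb k v).2 (hd k)
        have e2 := mul_le_mul_of_nonneg_left (hJb k v).2.1 (hdm k)
        have e3 := (hPb k v).1
        have e4 := (hJb k v).1
        rw [hc, hb, ha]
        constructor
        · linarith
        · linarith
      have hJG : ∀ v, v ⬝ᵥ Jmat f x k *ᵥ v ≤ c * (v ⬝ᵥ G k *ᵥ v) := fun v =>
        (hPJ v).1.trans (mul_le_mul_of_nonneg_left (i2 v) hc0.le)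
      have hξκ : 0 < ξ k * κ := mul_pos (by linarith [hξ1 k]) (by linarith)
      have hGJ : ∀ v, v ⬝ᵥ G k *ᵥ v ≤ ξ k * κ * c * (v ⬝ᵥ Jmat f x k *ᵥ v) := fun v => by
        have := mul_le_mul_of_nonneg_left (hPJ v).2 hξκ.le
        linarith [i3 v]
      obtain ⟨s1, s2, s3⟩ := SR1_bounds (hJs k) (i1.smul (IsSelfAdjoint.all c))
        (fun v => by simpa [smul_mulVec, dotProduct_smul] using hJG v) (x (k + 1) - x k)
      rw [← hGS k] at s1 s2 s3
      have hJP : Jprev f x (k + 1) = Jmat f x k := by simp [Jprev]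
      have g2 : ∀ v, v ⬝ᵥ Jprev f x (k + 1) *ᵥ v ≤ v ⬝ᵥ G (k + 1) *ᵥ v := by
        rw [hJP]; exact s2
      have hexp : ξ k * Real.exp (b + a) ≤ 3 / 2 := by
        rw [← hξS]; exact hξle (k + 1) i5
      have hκa : κ * a ≤ 1 / 8 := by
        have e1 : r k ≤ lamG f (x 0) := (i5 k (by omega)).trans
          (mul_le_of_le_one_left (hl0 _) (pow_le_one₀ hρ0 (by
            rw [hρ]; linarith [show 0 ≤ 1 / (2 * κ) by positivity])))
        have e2 := (mul_le_mul_of_nonneg_left e1 hM).trans hloc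
        rw [le_div_iff₀ (by positivity)] at e2
        have e3 := Real.log_le_sub_one_of_pos (show (0 : ℝ) < 3 / 2 by norm_num)
        linarith
      obtain ⟨t1, t2⟩ := exp_mul_contraction_le hκ (hξ1 k) ha0 hb0 hκa hexp
      have hθ0 : 0 ≤ ρ * Real.exp (-a) := mul_nonneg hρ0 (Real.exp_pos _).le
      have hgrad : grad f (x (k + 1)) =
          grad f (x k) - Jmat f x k *ᵥ ((G k)⁻¹ *ᵥ grad f (x k)) := by
        have hu : x (k + 1) - x k = -((G k)⁻¹ *ᵥ grad f (x k)) := by rw [hx]; abel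
        rw [grad_sub_grad hf hHs (x k) (x (k + 1)), hu, mulVec_neg, sub_eq_add_neg]
        rfl
      have hlam : lamG f (x (k + 1)) ≤ (1 + a / 2) * (ρ * Real.exp (-a)) * lamG f (x k) := by
        have := sqrt_inv_quadForm_residual_le (hHpd (x k)) (hHpd (x (k + 1))) (hJpd k) hGk hJG
          hGJ hc0.le (mul_pos hξκ hc0) t1 t2 hθ0 (hd k) (fun v => (hJb k v).2.1)
          (fun v => (hJb k v).2.2.1) (grad f (x k))
        rw [← hgrad] at this
        exact this
      have g4 : Real.exp (M * rm (k + 1) / 2) * lamG f (x (k + 1)) ≤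
          ρ ^ (k + 1) * lamG f (x 0) := by
        rw [hrmS]
        have e1 : Real.exp (a / 2) * (1 + a / 2) * Real.exp (-a) ≤ 1 := by
          calc Real.exp (a / 2) * (1 + a / 2) * Real.exp (-a)
              ≤ Real.exp (a / 2) * Real.exp (a / 2) * Real.exp (-a) := by
                gcongr
                linarith [Real.add_one_le_exp (a / 2)]
            _ = 1 := by rw [← Real.exp_add, ← Real.exp_add]; ring_nf; simp
        calc Real.exp (a / 2) * lamG f (x (k + 1))
            ≤ Real.exp (a / 2) * ((1 + a / 2) * (ρ * Real.exp (-a)) * lamG f (x k)) := by gcongr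
          _ = (Real.exp (a / 2) * (1 + a / 2) * Real.exp (-a)) * (ρ * lamG f (x k)) := by ring
          _ ≤ 1 * (ρ * (Real.exp (b / 2) * lamG f (x k))) := by
              have := hl0 (x k)
              gcongr
              exact le_mul_of_one_le_left this (Real.one_le_exp (by positivity))
          _ ≤ 1 * (ρ * (ρ ^ k * lamG f (x 0))) := by gcongr
          _ = ρ ^ (k + 1) * lamG f (x 0) := by ring
      refine ⟨s1, g2, fun v => ?_, g4, fun i hi => ?_⟩
      · rw [hJP, hξS]
        have e1 := s3 v
        rw [smul_mulVec, dotProduct_smul, smul_eq_mul] at e1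
        have e2 := mul_le_mul_of_nonneg_left (hGJ v) hc0.le
        have hc2 : c * c ≤ Real.exp (b + a) := by
          have f1 : c ≤ Real.exp (b / 2) * Real.exp (a / 2) := by
            rw [hc]
            gcongr
            · linarith [Real.add_one_le_exp (b / 2)]
            · linarith [Real.add_one_le_exp (a / 2)]
          calc c * c ≤ (Real.exp (b / 2) * Real.exp (a / 2)) *
                (Real.exp (b / 2) * Real.exp (a / 2)) := by gcongr
            _ = Real.exp (b + a) := by
                rw [← Real.exp_add, ← Real.exp_add]; ring_nf
        have e3 := mul_le_mul_of_nonneg_right hc2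
          (mul_nonneg hξκ.le ((hJpd k).quadForm_nonneg v))
        linarith
      · rcases Nat.lt_succ_iff_lt_or_eq.1 hi with h | rfl
        · exact i5 i h
        · exact hrk _ (hGpd _ s1 g2) g2 g4
  intro k
  obtain ⟨h1, h2, h3, h4, h5⟩ := main k
  refine ⟨(posSemidef_sub_iff_forall_le (hPs k) h1).2 h2,
    (posSemidef_sub_iff_forall_le h1 ((hPs k).smul (IsSelfAdjoint.all _))).2 fun v => ?_,
    hξle k fun i hi => h5 i (by omega), h4, h5 k (by omega)⟩
  rw [smul_mulVec, dotProduct_smul, smul_eq_mul]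
  exact h3 v
end
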